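/- arXiv:1108.0957 — 10 statements merged into one kernel-verified Lean document; each statement's English description precedes it below -/
import Mathlib

section
/- Let f be a multiplicative arithmetic function, p a prime, and m ≥ 0, N ≥ 1 integers. Then the scaled summatory function satisfies the functional equation F(f;N,p^m) = ∑_{r=0}^{⌊log_p N⌋} L_r(f;p^m) · F(f;⌊N/p^r⌋,1); that is, ∑_{k=1}^{N} f(p^m·k) = ∑_{r=0}^{⌊log_p N⌋} L_r(f;p^m) · ∑_{k=1}^{⌊N/p^r⌋} f(k). -/
/-- `f` is a multiplicative arithmetic function on the positive integers. -/
def IsMultiplicativeFn (f : ℕ → ℝ) : Prop :=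
  f 1 = 1 ∧ ∀ a b : ℕ, 0 < a → 0 < b → Nat.gcd a b = 1 → f (a * b) = f a * f b

/-- Characteristic functions `L_r(f; p^m)`, defined recursively by
`L_0 = f (p^m)` and `L_r = f (p^(m+r)) - ∑_{j<r} L_j · f (p^(r-j))`. -/
noncomputable def charL (f : ℕ → ℝ) (p m : ℕ) : ℕ → ℝ
  | 0 => f (p ^ m)
  | r + 1 =>
      f (p ^ (m + (r + 1))) -
        ∑ j : Fin (r + 1), charL f p m j * f (p ^ (r + 1 - (j : ℕ)))
  decreasing_by exact j.isLt

/-- The recursion for `charL`, solved for `f (p ^ (m + a))`. -/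
theorem charL_sum (f : ℕ → ℝ) (h1 : f 1 = 1) (p m a : ℕ) :
    f (p ^ (m + a)) = ∑ r ∈ Finset.range (a + 1), charL f p m r * f (p ^ (a - r)) := by
  cases a with
  | zero => simp [charL, h1]
  | succ a =>
    rw [Finset.sum_range_succ, Finset.sum_range]
    conv_rhs => rw [charL]
    simp [h1]

/-- Pointwise form of the functional equation. -/
theorem pointwise_scaling (f : ℕ → ℝ) (hf : IsMultiplicativeFn f) (p : ℕ) (hp : p.Prime)
    (m N k : ℕ) (hk : 1 ≤ k) (hkN : k ≤ N) :
    f (p ^ m * k) = ∑ r ∈ Finset.range (Nat.log p N + 1),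
      if p ^ r ∣ k then charL f p m r * f (k / p ^ r) else 0 := by
  obtain ⟨a, u, hu, rfl⟩ := Nat.exists_eq_pow_mul_and_not_dvd (n := k) (by omega) p hp.ne_one
  have hu0 : 0 < u := Nat.pos_of_ne_zero (by rintro rfl; simp at hu)
  have hmul : ∀ b, f (p ^ b * u) = f (p ^ b) * f u := fun b =>
    hf.2 _ _ (pow_pos hp.pos b) hu0 (Nat.Coprime.pow_left b ((Nat.Prime.coprime_iff_not_dvd hp).2 hu))
  have hdvd : ∀ r, p ^ r ∣ p ^ a * u ↔ r ≤ a := by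
    intro r
    constructor
    · intro h
      have hc : Nat.Coprime (p ^ r) u :=
        Nat.Coprime.pow_left r ((Nat.Prime.coprime_iff_not_dvd hp).2 hu)
      exact (Nat.pow_dvd_pow_iff_le_right hp.one_lt).1 (hc.dvd_of_dvd_mul_right h)
    · intro h
      exact (pow_dvd_pow p h).mul_right u
  have ha : a ≤ Nat.log p N := by
    apply Nat.le_log_of_pow_le hp.one_lt
    exact (Nat.le_mul_of_pos_right _ hu0).trans hkN
  rw [← mul_assoc, ← pow_add, hmul, charL_sum f hf.1, Finset.sum_mul]
  symm
  rw [← Finset.sum_subset (Finset.range_mono (Nat.succ_le_succ ha))]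
  · apply Finset.sum_congr rfl
    intro r hr
    have hra : r ≤ a := by simpa [Nat.lt_succ_iff] using hr
    rw [if_pos ((hdvd r).2 hra), mul_assoc, ← hmul]
    congr 2
    apply Nat.div_eq_of_eq_mul_right (pow_pos hp.pos r)
    rw [← mul_assoc, ← pow_add, Nat.add_sub_cancel' hra]
  · intro r _ hr
    rw [if_neg]
    rw [hdvd]
    simpa [Nat.lt_succ_iff] using hr

/-- Sum over multiples of `d`. -/
theorem sum_multiples (g : ℕ → ℝ) (c : ℝ) (d N : ℕ) (hd : 0 < d) :
    ∑ k ∈ Finset.Icc 1 N, (if d ∣ k then c * g (k / d) else 0) =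
      c * ∑ k ∈ Finset.Icc 1 (N / d), g k := by
  rw [← Finset.sum_filter, Finset.mul_sum]
  symm
  apply Finset.sum_bij (fun k _ => d * k)
  · intro k hk
    simp only [Finset.mem_Icc, Finset.mem_filter] at hk ⊢
    refine ⟨⟨Nat.mul_pos hd hk.1, ?_⟩, dvd_mul_right d k⟩
    rw [mul_comm]
    exact (Nat.le_div_iff_mul_le hd).1 hk.2
  · intro a _ b _ h
    exact Nat.eq_of_mul_eq_mul_left hd h
  · intro b hb
    simp only [Finset.mem_Icc, Finset.mem_filter] at hb
    obtain ⟨⟨h1, h2⟩, q, rfl⟩ := hb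
    refine ⟨q, ?_, rfl⟩
    rw [Finset.mem_Icc, Nat.le_div_iff_mul_le hd, mul_comm q]
    exact ⟨Nat.pos_of_mul_pos_left h1, h2⟩
  · intro k _
    rw [Nat.mul_div_cancel_left _ hd]

/-- the scaling functional equation
`F(f;N,p^m) = ∑_{r=0}^{⌊log_p N⌋} L_r(f;p^m) · F(f;⌊N/p^r⌋,1)`. -/
theorem summatory_scaling_functional_equation
    (f : ℕ → ℝ) (hf : IsMultiplicativeFn f) (p : ℕ) (hp : p.Prime)
    (m N : ℕ) (hN : 1 ≤ N) :
    ∑ k ∈ Finset.Icc 1 N, f (p ^ m * k) =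
      ∑ r ∈ Finset.range (Nat.log p N + 1),
        charL f p m r * ∑ k ∈ Finset.Icc 1 (N / p ^ r), f k := by
  rw [Finset.sum_congr rfl (fun k hk => pointwise_scaling f hf p hp m N k
    (Finset.mem_Icc.1 hk).1 (Finset.mem_Icc.1 hk).2), Finset.sum_comm]
  exact Finset.sum_congr rfl fun r _ => sum_multiples f _ _ N (pow_pos hp.pos r)
end

section
/- Let f be a multiplicative arithmetic function belonging to the universality class ℬ{N^{a1}(log N)^{b1}; N^{−a2}(log N)^{−b2}} with admissible parameters a1, b1, a2, b2, let p be a prime and m ≥ 0 an integer, and suppose there exist real numbers K > 0 and γ < a1 and an integer r* ≥ 0 such that |L_r(f;p^m)| ≤ K·p^{γr} for all r ≥ r*. Then the series ∑_{r=0}^{∞} L_r(f;p^m)·p^{−a1·r} converges, and the renormalization function R(f;N,p^m) = F(f;N,p^m)/F(f;N,1) tends to ∑_{r=0}^{∞} L_r(f;p^m)·p^{−a1·r} as N → ∞. -/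
open Filter

/-- Admissible parameters: `a1 > 0` (with `b1` arbitrary) or `a1 = 0, b1 ≥ 0`;
and `a2 > 0` (with `b2` arbitrary) or `a2 = 0, b2 > 0`. -/
def AdmissibleParams (a1 b1 a2 b2 : ℝ) : Prop :=
  (0 < a1 ∨ (a1 = 0 ∧ 0 ≤ b1)) ∧ (0 < a2 ∨ (a2 = 0 ∧ 0 < b2))

/-- `f` belongs to the universality class `ℬ{N^{a1}(log N)^{b1}; N^{-a2}(log N)^{-b2}}`. -/
def InUniversalityClass (f : ℕ → ℝ) (a1 b1 a2 b2 : ℝ) : Prop :=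
  ∃ Fc C : ℝ, 0 < Fc ∧ 0 < C ∧
    Tendsto (fun N : ℕ =>
        (∑ k ∈ Finset.Icc 1 N, f k) / (Fc * (N : ℝ) ^ a1 * Real.log N ^ b1))
      atTop (nhds 1) ∧
    ∀ᶠ N : ℕ in atTop,
      |(∑ k ∈ Finset.Icc 1 N, f k) / (Fc * (N : ℝ) ^ a1 * Real.log N ^ b1) - 1|
        < C * (N : ℝ) ^ (-a2) * Real.log N ^ (-b2)

lemma rlc_pow_expand (f : ℕ → ℝ) (p m : ℕ) (h1 : f 1 = 1) (s : ℕ) :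
    f (p ^ (m + s)) = ∑ r ∈ Finset.range (s + 1), charL f p m r * f (p ^ (s - r)) := by
  rw [Finset.sum_range_succ]
  cases s with
  | zero => simp [charL, h1]
  | succ s =>
    rw [charL, Finset.sum_range]
    simp [h1]

lemma rlc_term_expand (f : ℕ → ℝ) (p m : ℕ) (hf : IsMultiplicativeFn f) (hp : p.Prime)
    (N k : ℕ) (hk : 1 ≤ k) (hkN : k ≤ N) :
    f (p ^ m * k) = ∑ r ∈ Finset.range (N + 1),
      if p ^ r ∣ k then charL f p m r * f (k / p ^ r) else 0 := by
  obtain ⟨s, k', hk', rfl⟩ := Nat.exists_eq_pow_mul_and_not_dvd (by omega : k ≠ 0) p hp.one_lt.ne'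
  have hk0 : 0 < k' := Nat.pos_of_ne_zero (by rintro rfl; simp at hk')
  have hpp : 0 < p := hp.pos
  have hcop : ∀ t, Nat.gcd (p ^ t) k' = 1 := fun t =>
    Nat.Coprime.pow_left t ((Nat.Prime.coprime_iff_not_dvd hp).2 hk')
  have hsN : s ≤ N := by
    have h1 : s < p ^ s := Nat.lt_pow_self hp.one_lt
    have h2 : p ^ s ≤ p ^ s * k' := Nat.le_mul_of_pos_right _ hk0
    omega
  have hdvd : ∀ r, p ^ r ∣ p ^ s * k' ↔ r ≤ s := by
    intro r
    constructor
    · intro h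
      exact (Nat.pow_dvd_pow_iff_le_right hp.one_lt).1
        (Nat.Coprime.dvd_of_dvd_mul_right (hcop r) h)
    · intro h
      exact Dvd.dvd.mul_right (pow_dvd_pow p h) _
  rw [← mul_assoc, ← pow_add, hf.2 _ _ (pow_pos hpp _) hk0 (hcop _), rlc_pow_expand f p m hf.1 s,
    Finset.sum_mul]
  rw [← Finset.sum_subset (Finset.range_subset_range.2 (by omega : s + 1 ≤ N + 1))]
  · apply Finset.sum_congr rfl
    intro r hr
    have hr' : r ≤ s := by have := Finset.mem_range.1 hr; omega
    rw [if_pos ((hdvd r).2 hr')]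
    have : p ^ s * k' / p ^ r = p ^ (s - r) * k' := by
      apply Nat.div_eq_of_eq_mul_right (pow_pos hpp _)
      rw [← mul_assoc, ← pow_add]
      congr 2; omega
    rw [this, hf.2 _ _ (pow_pos hpp _) hk0 (hcop _), mul_assoc]
  · intro r _ hr
    rw [if_neg]
    rw [hdvd]
    simpa using hr

lemma rlc_sum_dvd (f : ℕ → ℝ) (c : ℝ) (q N : ℕ) (hq : 0 < q) :
    (∑ k ∈ Finset.Icc 1 N, if q ∣ k then c * f (k / q) else 0)
      = c * ∑ k ∈ Finset.Icc 1 (N / q), f k := by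
  rw [← Finset.sum_filter, Finset.mul_sum]
  symm
  refine Finset.sum_nbij' (fun j => q * j) (fun k => k / q) ?_ ?_ ?_ ?_ ?_
  · intro j hj
    simp only [Finset.mem_Icc, Finset.mem_filter] at hj ⊢
    refine ⟨⟨Nat.mul_pos hq hj.1, ?_⟩, dvd_mul_right _ _⟩
    have := (Nat.le_div_iff_mul_le hq).1 hj.2
    rwa [mul_comm]
  · intro k hk
    simp only [Finset.mem_Icc, Finset.mem_filter] at hk ⊢
    exact ⟨Nat.div_pos (Nat.le_of_dvd hk.1.1 hk.2) hq, Nat.div_le_div_right hk.1.2⟩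
  · intro j _
    exact Nat.mul_div_cancel_left j hq
  · intro k hk
    simp only [Finset.mem_Icc, Finset.mem_filter] at hk
    exact Nat.mul_div_cancel' hk.2
  · intro j _
    rw [Nat.mul_div_cancel_left j hq]

lemma rlc_sum_expand (f : ℕ → ℝ) (p m : ℕ) (hf : IsMultiplicativeFn f) (hp : p.Prime) (N : ℕ) :
    ∑ k ∈ Finset.Icc 1 N, f (p ^ m * k) = ∑ r ∈ Finset.range (N + 1),
      charL f p m r * ∑ k ∈ Finset.Icc 1 (N / p ^ r), f k := by
  rw [Finset.sum_congr rfl (fun k hk => rlc_term_expand f p m hf hp N k (Finset.mem_Icc.1 hk).1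
    (Finset.mem_Icc.1 hk).2), Finset.sum_comm]
  exact Finset.sum_congr rfl fun r _ => rlc_sum_dvd f _ _ N (pow_pos hp.pos _)

lemma rlc_div_tendsto (q : ℕ) (hq : 0 < q) :
    Tendsto (fun N : ℕ => ((N / q : ℕ) : ℝ) / N) atTop (nhds ((q : ℝ)⁻¹)) := by
  have h := (tendsto_nat_floor_mul_div_atTop (R := ℝ) (a := (q : ℝ)⁻¹) (by positivity)).comp
    tendsto_natCast_atTop_atTop
  refine h.congr fun N => ?_
  simp only [Function.comp]
  rw [inv_mul_eq_div, Nat.floor_div_eq_div]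

lemma rlc_log_tendsto (q : ℕ) (hq : 0 < q) :
    Tendsto (fun N : ℕ => Real.log ((N / q : ℕ) : ℝ) / Real.log N) atTop (nhds 1) := by
  have hlog : Tendsto (fun N : ℕ => Real.log (N : ℝ)) atTop atTop :=
    Real.tendsto_log_atTop.comp tendsto_natCast_atTop_atTop
  have hq' : (q : ℝ)⁻¹ ≠ 0 := by positivity
  have h1 := ((rlc_div_tendsto q hq).log hq').div_atTop hlog
  have h2 := h1.const_add 1
  rw [add_zero] at h2
  refine h2.congr' ?_
  filter_upwards [eventually_ge_atTop (q + 2)] with N hN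
  have hn : 0 < N / q := Nat.div_pos (by omega) hq
  have hn' : ((N / q : ℕ) : ℝ) ≠ 0 := by positivity
  have hN2 : (N : ℝ) ≠ 0 := by
    have : N ≠ 0 := by omega
    exact_mod_cast this
  have hl : Real.log N ≠ 0 := by
    apply ne_of_gt
    apply Real.log_pos
    exact_mod_cast (by omega : 1 < N)
  rw [Real.log_div hn' hN2]
  field_simp
  ring

/-- the ratio at fixed scale -/
lemma rlc_ratio_tendsto (F : ℕ → ℝ) (a b c : ℝ) (hc : 0 < c)
    (hF : Tendsto (fun N : ℕ => F N / (c * (N : ℝ) ^ a * Real.log N ^ b)) atTop (nhds 1))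
    (q : ℕ) (hq : 0 < q) :
    Tendsto (fun N : ℕ => F (N / q) / F N) atTop (nhds ((q : ℝ) ^ (-a))) := by
  have hdiv : Tendsto (fun N : ℕ => N / q) atTop atTop := Nat.tendsto_div_const_atTop hq.ne'
  have h1 := hF.comp hdiv
  have h2 := hF.inv₀ one_ne_zero
  have h3 := (rlc_div_tendsto q hq).rpow_const (p := a) (Or.inl (by positivity))
  have h4 := (rlc_log_tendsto q hq).rpow_const (p := b) (Or.inl one_ne_zero)
  have h5 := (h1.mul h2).mul (h3.mul h4)
  have e : (1 : ℝ) * 1⁻¹ * ((q : ℝ)⁻¹ ^ a * 1 ^ b) = (q : ℝ) ^ (-a) := by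
    rw [Real.one_rpow, Real.rpow_neg (by positivity), Real.inv_rpow (by positivity)]; simp
  rw [e] at h5
  refine h5.congr' ?_
  filter_upwards [eventually_ge_atTop (q * 2 + 2)] with N hN
  have hn : 2 ≤ N / q := (Nat.le_div_iff_mul_le hq).2 (by linarith)
  have hN2 : (2 : ℕ) ≤ N := by omega
  simp only [Function.comp]
  have hlogn : 0 < Real.log ((N / q : ℕ) : ℝ) := Real.log_pos (by exact_mod_cast (by omega : 1 < N / q))
  have hlogN : 0 < Real.log (N : ℝ) := Real.log_pos (by exact_mod_cast (by omega : 1 < N))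
  have hnp : (0 : ℝ) < ((N / q : ℕ) : ℝ) := by exact_mod_cast (by omega : 0 < N / q)
  have hNp : (0 : ℝ) < (N : ℝ) := by exact_mod_cast (by omega : 0 < N)
  rw [Real.div_rpow hnp.le hNp.le, Real.div_rpow hlogn.le hlogN.le]
  have := Real.rpow_pos_of_pos hlogn b
  have := Real.rpow_pos_of_pos hlogN b
  have := Real.rpow_pos_of_pos hnp a
  have := Real.rpow_pos_of_pos hNp a
  by_cases h0 : F N = 0
  · simp [h0]
  · field_simp

lemma rlc_mono (e b : ℝ) (h : 0 < e ∨ (e = 0 ∧ 0 ≤ b)) :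
    ∃ x0 : ℝ, 2 ≤ x0 ∧ ∀ x y : ℝ, x0 ≤ x → x ≤ y →
      x ^ e * Real.log x ^ b ≤ y ^ e * Real.log y ^ b := by
  have he : 0 ≤ e := by rcases h with h | h <;> linarith
  by_cases hb : 0 ≤ b
  · refine ⟨2, le_rfl, fun x y hx hxy => ?_⟩
    have hl : 0 < Real.log x := Real.log_pos (by linarith)
    have hll : Real.log x ≤ Real.log y := Real.log_le_log (by linarith) hxy
    have hy : 0 ≤ y ^ e := Real.rpow_nonneg (by linarith) e
    gcongr
  · have he' : 0 < e := by
      rcases h with h | h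
      · exact h
      · exact absurd h.2 hb
    push Not at hb
    have ha : 0 < e / (-b) := div_pos he' (by linarith)
    refine ⟨max 2 (Real.exp (e / (-b))⁻¹), le_max_left _ _, fun x y hx hxy => ?_⟩
    have hx2 : 2 ≤ x := (le_max_left _ _).trans hx
    have hx3 := (le_max_right _ _).trans hx
    have hanti := Real.log_div_self_rpow_antitoneOn ha (Set.mem_Ici.2 hx3)
      (Set.mem_Ici.2 (hx3.trans hxy)) hxy
    simp only at hanti
    have key : ∀ z : ℝ, 2 ≤ z → (Real.log z / z ^ (e / (-b))) ^ b = z ^ e * Real.log z ^ b := by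
      intro z hz
      have hl : 0 < Real.log z := Real.log_pos (by linarith)
      have hz0 : 0 ≤ z := by linarith
      rw [Real.div_rpow hl.le (by positivity), ← Real.rpow_mul hz0]
      have : e / (-b) * b = -e := by
        have : b ≠ 0 := hb.ne
        field_simp
      rw [this, Real.rpow_neg hz0, div_inv_eq_mul, mul_comm]
    rw [← key x hx2, ← key y (hx2.trans hxy)]
    have hl : 0 < Real.log y := Real.log_pos (by linarith)
    apply Real.rpow_le_rpow_of_nonpos _ hanti hb.le
    have : 0 < y := by linarith
    positivity

lemma rlc_bound (F : ℕ → ℝ) (a b c d : ℝ) (hc : 0 < c) (hF0 : F 0 = 0)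
    (hF : Tendsto (fun N : ℕ => F N / (c * (N : ℝ) ^ a * Real.log N ^ b)) atTop (nhds 1))
    (hd : 0 ≤ d) (hd' : 0 < a - d ∨ (a - d = 0 ∧ 0 ≤ b)) :
    ∃ C : ℝ, 0 ≤ C ∧ ∀ᶠ N : ℕ in atTop, ∀ q : ℕ, 0 < q →
      |F (N / q) / F N| ≤ C * (q : ℝ) ^ (-d) := by
  obtain ⟨x0, hx0, hmono⟩ := rlc_mono (a - d) b hd'
  have hev : ∀ᶠ N : ℕ in atTop, 1 / 2 < F N / (c * (N : ℝ) ^ a * Real.log N ^ b) ∧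
      F N / (c * (N : ℝ) ^ a * Real.log N ^ b) < 2 :=
    (hF.eventually_const_lt (by norm_num)).and (hF.eventually_lt_const (by norm_num))
  obtain ⟨n1, hn1⟩ := eventually_atTop.1 hev
  set n0 := max n1 ⌈x0⌉₊ with hn0
  set H : ℕ → ℝ := fun n => (n : ℝ) ^ (a - d) * Real.log n ^ b with hH
  have hx0n : ∀ n : ℕ, n0 ≤ n → x0 ≤ (n : ℝ) := fun n hn =>
    (Nat.le_ceil x0).trans (by exact_mod_cast (le_max_right _ _).trans hn)
  have hHpos : ∀ n : ℕ, n0 ≤ n → 0 < H n := by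
    intro n hn
    have h1 := hx0n n hn
    have hl : 0 < Real.log (n : ℝ) := Real.log_pos (by linarith)
    have hnp : (0 : ℝ) < n := by linarith
    exact mul_pos (Real.rpow_pos_of_pos hnp _) (Real.rpow_pos_of_pos hl _)
  have hbds : ∀ n : ℕ, n0 ≤ n → c / 2 * H n ≤ F n * (n : ℝ) ^ (-d) ∧
      F n * (n : ℝ) ^ (-d) ≤ 2 * c * H n := by
    intro n hn
    have h1 := hx0n n hn
    have hl : 0 < Real.log (n : ℝ) := Real.log_pos (by linarith)
    have hnp : (0 : ℝ) < n := by linarith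
    have hlb := Real.rpow_pos_of_pos hl b
    have hna := Real.rpow_pos_of_pos hnp a
    have hnd := Real.rpow_pos_of_pos hnp (-d)
    have hG : 0 < c * (n : ℝ) ^ a * Real.log n ^ b := by positivity
    obtain ⟨h2, h3⟩ := hn1 n ((le_max_left _ _).trans hn)
    rw [lt_div_iff₀ hG] at h2
    rw [div_lt_iff₀ hG] at h3
    have hHe : H n = (n : ℝ) ^ a * Real.log n ^ b * (n : ℝ) ^ (-d) := by
      simp only [hH]
      rw [sub_eq_add_neg, Real.rpow_add hnp]; ring
    rw [hHe]
    constructor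
    · have := mul_le_mul_of_nonneg_right h2.le hnd.le
      linarith
    · have := mul_le_mul_of_nonneg_right h3.le hnd.le
      linarith
  set M : ℝ := ∑ n ∈ Finset.range n0, |F n| * (n : ℝ) ^ (-d) with hM
  have hMterm : ∀ n : ℕ, 0 ≤ |F n| * (n : ℝ) ^ (-d) := fun n =>
    mul_nonneg (abs_nonneg _) (Real.rpow_nonneg (Nat.cast_nonneg _) _)
  have hM0 : 0 ≤ M := Finset.sum_nonneg fun n _ => hMterm n
  have hH0 := hHpos n0 le_rfl
  set C : ℝ := 4 + 2 * M / (c * H n0) with hC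
  have hC0 : 0 ≤ C := by positivity
  refine ⟨C, hC0, ?_⟩
  filter_upwards [eventually_ge_atTop n0] with N hN q hq
  have hNp : (0 : ℝ) < N := by linarith [hx0n N hN]
  have hqp : (0 : ℝ) < q := by exact_mod_cast hq
  have hNd := Real.rpow_pos_of_pos hNp (-d)
  have hHN := hHpos N hN
  have hFN : 0 < F N := by
    have h1 : 0 < F N * (N : ℝ) ^ (-d) := lt_of_lt_of_le (by positivity) (hbds N hN).1
    exact pos_of_mul_pos_left h1 hNd.le
  have hHmono : ∀ i j : ℕ, n0 ≤ i → i ≤ j → H i ≤ H j := fun i j hi hij =>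
    hmono i j (hx0n i hi) (by exact_mod_cast hij)
  generalize hn : N / q = n
  have hnq : n * q ≤ N := hn ▸ Nat.div_mul_le_self N q
  have hnN : n ≤ N := hn ▸ Nat.div_le_self N q
  rcases Nat.eq_zero_or_pos n with rfl | hnpos
  · rw [hF0]; simp; positivity
  have hnp : (0 : ℝ) < n := by exact_mod_cast hnpos
  have main : |F n| * (n : ℝ) ^ (-d) ≤ C * (F N * (N : ℝ) ^ (-d)) := by
    have hlow := (hbds N hN).1
    have hX : 0 ≤ F N * (N : ℝ) ^ (-d) := by positivity
    have hMd : 0 ≤ 2 * M / (c * H n0) := by positivity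
    rcases le_or_gt n0 n with h | h
    · have hFn : 0 ≤ F n := by
        have h1 : 0 < F n * (n : ℝ) ^ (-d) :=
          lt_of_lt_of_le (mul_pos (by positivity) (hHpos n h)) (hbds n h).1
        exact (pos_of_mul_pos_left h1 (Real.rpow_nonneg hnp.le _)).le
      rw [abs_of_nonneg hFn]
      have h2 := (hbds n h).2
      have h3 := mul_le_mul_of_nonneg_left (hHmono n N h hnN) hc.le
      have h4 := mul_nonneg hMd hX
      rw [hC]
      nlinarith
    · have h1 : |F n| * (n : ℝ) ^ (-d) ≤ M :=
        Finset.single_le_sum (f := fun n : ℕ => |F n| * (n : ℝ) ^ (-d))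
          (fun i _ => hMterm i) (Finset.mem_range.2 h)
      have h2 : c / 2 * H n0 ≤ F N * (N : ℝ) ^ (-d) :=
        (mul_le_mul_of_nonneg_left (hHmono n0 N le_rfl hN) (by positivity)).trans hlow
      have h3 := mul_le_mul_of_nonneg_left h2 hMd
      have h4 : 2 * M / (c * H n0) * (c / 2 * H n0) = M := by field_simp
      rw [hC]
      nlinarith
  rw [abs_div, abs_of_pos hFN, div_le_iff₀ hFN]
  have hnd := Real.rpow_pos_of_pos hnp d
  have e1 : |F n| = |F n| * (n : ℝ) ^ (-d) * (n : ℝ) ^ d := by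
    rw [mul_assoc, ← Real.rpow_add hnp]; simp
  have e2 : (n : ℝ) ^ d * (N : ℝ) ^ (-d) ≤ (q : ℝ) ^ (-d) := by
    rw [Real.rpow_neg hNp.le, Real.rpow_neg hqp.le, ← div_eq_mul_inv,
      div_le_iff₀ (Real.rpow_pos_of_pos hNp d), inv_mul_eq_div,
      le_div_iff₀ (Real.rpow_pos_of_pos hqp d), ← Real.mul_rpow hnp.le hqp.le]
    exact Real.rpow_le_rpow (by positivity) (by exact_mod_cast hnq) hd
  calc |F n| = |F n| * (n : ℝ) ^ (-d) * (n : ℝ) ^ d := e1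
    _ ≤ C * (F N * (N : ℝ) ^ (-d)) * (n : ℝ) ^ d := mul_le_mul_of_nonneg_right main hnd.le
    _ = C * F N * ((n : ℝ) ^ d * (N : ℝ) ^ (-d)) := by ring
    _ ≤ C * F N * (q : ℝ) ^ (-d) := mul_le_mul_of_nonneg_left e2 (by positivity)
    _ = C * (q : ℝ) ^ (-d) * F N := by ring

lemma rlc_summable (L : ℕ → ℝ) (p : ℕ) (hp : 1 < p) (K γ d : ℝ) (hγ : γ < d) (rstar : ℕ)
    (hL : ∀ r : ℕ, rstar ≤ r → |L r| ≤ K * (p : ℝ) ^ (γ * r)) :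
    Summable (fun r : ℕ => |L r| * (p : ℝ) ^ (-(d * r))) := by
  have hp1 : (1 : ℝ) < p := by exact_mod_cast hp
  have hp0 : (0 : ℝ) < p := by linarith
  have hg : Summable (fun r : ℕ => K * ((p : ℝ) ^ (γ - d)) ^ r) :=
    (summable_geometric_of_lt_one (Real.rpow_nonneg hp0.le _)
      (Real.rpow_lt_one_of_one_lt_of_neg hp1 (by linarith))).mul_left K
  refine Summable.of_norm_bounded_eventually_nat hg ?_
  filter_upwards [eventually_ge_atTop rstar] with r hr
  have h1 := Real.rpow_pos_of_pos hp0 (-(d * r))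
  rw [Real.norm_eq_abs, abs_of_nonneg (mul_nonneg (abs_nonneg _) h1.le)]
  refine (mul_le_mul_of_nonneg_right (hL r hr) h1.le).trans (le_of_eq ?_)
  rw [mul_assoc, ← Real.rpow_add hp0, ← Real.rpow_natCast, ← Real.rpow_mul hp0.le]
  congr 2; ring

/-- Theorem 1 of the paper: under the growth constraint on the
characteristic functions, the series `∑ L_r(f;p^m) p^{-a1 r}` converges and the
renormalization function `R(f;N,p^m)` tends to its sum. -/
theorem renormalization_limit_charL
    (f : ℕ → ℝ) (a1 b1 a2 b2 : ℝ) (p m : ℕ)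
    (hf : IsMultiplicativeFn f) (hp : p.Prime)
    (hadm : AdmissibleParams a1 b1 a2 b2)
    (hclass : InUniversalityClass f a1 b1 a2 b2)
    (K γ : ℝ) (hK : 0 < K) (hγ : γ < a1) (rstar : ℕ)
    (hL : ∀ r : ℕ, rstar ≤ r → |charL f p m r| ≤ K * (p : ℝ) ^ (γ * r)) :
    Summable (fun r : ℕ => charL f p m r * (p : ℝ) ^ (-(a1 * r))) ∧
    Tendsto (fun N : ℕ =>
        (∑ k ∈ Finset.Icc 1 N, f (p ^ m * k)) / (∑ k ∈ Finset.Icc 1 N, f k))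
      atTop (nhds (∑' r : ℕ, charL f p m r * (p : ℝ) ^ (-(a1 * r)))) := by
  have hp1 : (1 : ℝ) < p := by exact_mod_cast hp.one_lt
  have hp0 : (0 : ℝ) < p := by linarith
  have hsum := rlc_summable (charL f p m) p hp.one_lt K γ a1 hγ rstar hL
  refine ⟨?_, ?_⟩
  · refine Summable.of_norm (hsum.congr fun r => ?_)
    rw [Real.norm_eq_abs, abs_mul, abs_of_pos (Real.rpow_pos_of_pos hp0 _)]
  obtain ⟨c, C', hc, -, hF, -⟩ := hclass
  set F : ℕ → ℝ := fun N => ∑ k ∈ Finset.Icc 1 N, f k with hFdef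
  have hF' : Tendsto (fun N : ℕ => F N / (c * (N : ℝ) ^ a1 * Real.log N ^ b1)) atTop (nhds 1) := hF
  have hF0 : F 0 = 0 := by simp [hFdef]
  have ha1 : 0 ≤ a1 := by rcases hadm.1 with h | h <;> linarith
  obtain ⟨d, hd, hdγ, hd'⟩ : ∃ d : ℝ, 0 ≤ d ∧ γ < d ∧ (0 < a1 - d ∨ (a1 - d = 0 ∧ 0 ≤ b1)) := by
    rcases hadm.1 with h | h
    · refine ⟨max 0 ((a1 + γ) / 2), le_max_left _ _,
        lt_of_lt_of_le (by linarith) (le_max_right _ _), Or.inl ?_⟩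
      rw [sub_pos]
      exact max_lt h (by linarith)
    · exact ⟨0, le_rfl, by linarith, Or.inr ⟨by linarith, h.2⟩⟩
  obtain ⟨C, hC, hbound⟩ := rlc_bound F a1 b1 c d hc hF0 hF' hd hd'
  have hpr : ∀ (r : ℕ) (x : ℝ), ((p ^ r : ℕ) : ℝ) ^ (-x) = (p : ℝ) ^ (-(x * r)) := by
    intro r x
    rw [Nat.cast_pow, ← Real.rpow_natCast, ← Real.rpow_mul hp0.le]
    congr 1; ring
  have hsumd := (rlc_summable (charL f p m) p hp.one_lt K γ d hdγ rstar hL).mul_left C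
  have hlim : Tendsto (fun N : ℕ => ∑' r : ℕ, charL f p m r * (F (N / p ^ r) / F N)) atTop
      (nhds (∑' r : ℕ, charL f p m r * (p : ℝ) ^ (-(a1 * r)))) := by
    refine tendsto_tsum_of_dominated_convergence hsumd ?_ ?_
    · intro r
      have := rlc_ratio_tendsto F a1 b1 c hc hF' (p ^ r) (pow_pos hp.pos r)
      rw [hpr] at this
      exact this.const_mul _
    · filter_upwards [hbound] with N hN r
      have h1 := hN (p ^ r) (pow_pos hp.pos r)
      rw [hpr] at h1
      rw [Real.norm_eq_abs, abs_mul]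
      have := mul_le_mul_of_nonneg_left h1 (abs_nonneg (charL f p m r))
      linarith
  refine hlim.congr fun N => ?_
  rw [rlc_sum_expand f p m hf hp N, Finset.sum_div,
    tsum_eq_sum (s := Finset.range (N + 1))]
  · exact Finset.sum_congr rfl fun r _ => (mul_div_assoc _ _ _).symm
  · intro r hr
    have hr' : N < r := by simpa using hr
    have : N / p ^ r = 0 := Nat.div_eq_of_lt (hr'.trans (Nat.lt_pow_self hp.one_lt))
    rw [this, hF0]; simp
end

section
/- Let f be a multiplicative arithmetic function belonging to the universality class ℬ{N^{a1}(log N)^{b1}; N^{−a2}(log N)^{−b2}} with admissible parameters, let p_1, ..., p_n be n distinct primes and m_1, ..., m_n ≥ 0 integers, and suppose there exist real numbers K > 0 and γ < a1 and an integer r* ≥ 0 such that |L_r(f;p_i^{m_i})| ≤ K·p_i^{γr} for every 1 ≤ i ≤ n and all r ≥ r*. Then [∑_{k=1}^{N} f(k·∏_{i=1}^{n} p_i^{m_i})] / [∑_{k=1}^{N} f(k)] tends to ∏_{i=1}^{n} ( ∑_{r=0}^{∞} L_r(f;p_i^{m_i})·p_i^{−a1·r} ) as N → ∞. -/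
open Filter

theorem charL_conv (f : ℕ → ℝ) (h1 : f 1 = 1) (q m v : ℕ) :
    ∑ r ∈ Finset.range (v + 1), charL f q m r * f (q ^ (v - r)) = f (q ^ (m + v)) := by
  rw [Finset.sum_range_succ]
  cases v with
  | zero => simp [charL, h1]
  | succ r =>
    have h2 : charL f q m (r + 1) = f (q ^ (m + (r + 1))) -
        ∑ j : Fin (r + 1), charL f q m j * f (q ^ (r + 1 - (j : ℕ))) := by
      rw [charL]
    rw [h2, Finset.sum_range (fun j => charL f q m j * f (q ^ (r + 1 - j)))]
    simp [h1]

theorem pointwise_id (f : ℕ → ℝ) (hf : IsMultiplicativeFn f) (q m M N k : ℕ) (hq : q.Prime)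
    (hM : 0 < M) (hqM : Nat.Coprime q M) (hk : 0 < k) (hkN : k ≤ N) :
    f (k * (q ^ m * M)) = ∑ r ∈ Finset.range (N + 1),
      if q ^ r ∣ k then charL f q m r * f (k / q ^ r * M) else 0 := by
  obtain ⟨v, u, hu, rfl⟩ := Nat.exists_eq_pow_mul_and_not_dvd hk.ne' q hq.ne_one
  have hu0 : 0 < u := Nat.pos_of_mul_pos_left hk
  have hcop : Nat.Coprime q (u * M) :=
    Nat.Coprime.mul_right ((Nat.Prime.coprime_iff_not_dvd hq).2 hu) hqM
  have hqp : 0 < q := hq.pos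
  have hfac : ∀ j, f (q ^ j * (u * M)) = f (q ^ j) * f (u * M) := fun j =>
    hf.2 _ _ (by positivity) (by positivity) (Nat.Coprime.pow_left j hcop)
  have hvN : v < N + 1 := by
    have h1 : v < q ^ v := Nat.lt_pow_self hq.one_lt
    have h2 : q ^ v ≤ q ^ v * u := Nat.le_mul_of_pos_right _ hu0
    omega
  have hdvd : ∀ r, q ^ r ∣ q ^ v * u ↔ r < v + 1 := by
    intro r
    constructor
    · intro h
      by_contra hr
      have h3 : q ^ (v + 1) ∣ q ^ v * u := (pow_dvd_pow q (by omega)).trans h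
      rw [pow_succ] at h3
      exact hu (Nat.dvd_of_mul_dvd_mul_left (by positivity) h3)
    · intro h
      exact (pow_dvd_pow q (by omega)).mul_right u
  have e1 : q ^ v * u * (q ^ m * M) = q ^ (m + v) * (u * M) := by ring
  rw [e1, hfac, ← charL_conv f hf.1, Finset.sum_mul, ← Finset.sum_filter]
  have e2 : (Finset.range (N + 1)).filter (fun r => q ^ r ∣ q ^ v * u) = Finset.range (v + 1) := by
    ext r
    simp only [Finset.mem_filter, Finset.mem_range, hdvd]
    omega
  rw [e2]
  refine Finset.sum_congr rfl fun r hr => ?_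
  have hrv : r ≤ v := by simpa [Nat.lt_succ_iff] using hr
  have e3 : q ^ v * u / q ^ r * M = q ^ (v - r) * (u * M) := by
    have : q ^ v = q ^ r * q ^ (v - r) := by rw [← pow_add]; congr 1; omega
    rw [this, mul_assoc, Nat.mul_div_cancel_left _ (by positivity)]
    ring
  rw [e3, hfac]; ring

theorem sum_dvd (g : ℕ → ℝ) (d N : ℕ) (hd : 0 < d) :
    ∑ k ∈ Finset.Icc 1 N, (if d ∣ k then g (k / d) else 0) = ∑ j ∈ Finset.Icc 1 (N / d), g j := by
  rw [← Finset.sum_filter]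
  refine Finset.sum_nbij' (fun k => k / d) (fun j => j * d) ?_ ?_ ?_ ?_ ?_
  · intro k hk
    simp only [Finset.mem_filter, Finset.mem_Icc] at hk ⊢
    obtain ⟨⟨h1, h2⟩, h3⟩ := hk
    exact ⟨Nat.div_pos (Nat.le_of_dvd h1 h3) hd, Nat.div_le_div_right h2⟩
  · intro j hj
    simp only [Finset.mem_filter, Finset.mem_Icc] at hj ⊢
    refine ⟨⟨Nat.mul_pos hj.1 hd, ?_⟩, dvd_mul_left _ _⟩
    exact (Nat.le_div_iff_mul_le hd).1 hj.2
  · intro k hk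
    simp only [Finset.mem_filter] at hk
    exact Nat.div_mul_cancel hk.2
  · intro j _
    exact Nat.mul_div_cancel _ hd
  · intros; rfl

theorem sum_id (f : ℕ → ℝ) (hf : IsMultiplicativeFn f) (q m M N : ℕ) (hq : q.Prime)
    (hM : 0 < M) (hqM : Nat.Coprime q M) :
    ∑ k ∈ Finset.Icc 1 N, f (k * (q ^ m * M)) =
      ∑' r : ℕ, charL f q m r * ∑ j ∈ Finset.Icc 1 (N / q ^ r), f (j * M) := by
  rw [tsum_eq_sum (s := Finset.range (N + 1))]
  · rw [Finset.sum_congr rfl (fun k hk => pointwise_id f hf q m M N k hq hM hqM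
      (Finset.mem_Icc.1 hk).1 (Finset.mem_Icc.1 hk).2), Finset.sum_comm]
    refine Finset.sum_congr rfl fun r _ => ?_
    rw [← sum_dvd (fun j => f (j * M)) (q ^ r) N (pow_pos hq.pos r), Finset.mul_sum]
    refine Finset.sum_congr rfl fun k _ => ?_
    split_ifs <;> simp
  · intro r hr
    have hr' : N < r := by simpa using hr
    have h1 : r < q ^ r := Nat.lt_pow_self hq.one_lt
    rw [Nat.div_eq_of_lt (by omega)]
    simp

/-- The scale function. -/
noncomputable def phiS (a b : ℝ) (N : ℕ) : ℝ := (N : ℝ) ^ a * Real.log N ^ b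

theorem one_le_log {N : ℕ} (h : 3 ≤ N) : 1 ≤ Real.log N := by
  rw [Real.le_log_iff_exp_le (by positivity)]
  have : (3 : ℝ) ≤ N := by exact_mod_cast h
  linarith [Real.exp_one_lt_d9]

theorem phiS_pos (a b : ℝ) {N : ℕ} (h : 3 ≤ N) : 0 < phiS a b N := by
  have h1 := one_le_log h
  have h2 : (0 : ℝ) < N := by positivity
  have h3 : 0 < Real.log N := by linarith
  unfold phiS
  positivity

theorem almost_mono (e b : ℝ) (h : 0 < e ∨ (e = 0 ∧ 0 ≤ b)) :
    ∃ C : ℝ, 0 < C ∧ ∀ M N : ℕ, 3 ≤ M → M ≤ N → phiS e b M ≤ C * phiS e b N := by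
  by_cases hb : 0 ≤ b
  · refine ⟨1, one_pos, fun M N hM hMN => ?_⟩
    have he : 0 ≤ e := by rcases h with h | h <;> linarith
    have hl := one_le_log hM
    have hM0 : (0 : ℝ) < M := by positivity
    have hMN' : (M : ℝ) ≤ N := by exact_mod_cast hMN
    rw [one_mul]
    unfold phiS
    gcongr
  · have he : 0 < e := by
      rcases h with h | h
      · exact h
      · exact absurd h.2 hb
    push Not at hb
    obtain ⟨c, hc⟩ : ∃ c : ℝ, c = -b := ⟨_, rfl⟩
    have hc0 : 0 < c := by linarith
    set η := e / c with hη
    have hη0 : 0 < η := by positivity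
    refine ⟨(1 + 1 / η) ^ c, by positivity, fun M N hM hMN => ?_⟩
    have hl := one_le_log hM
    have hlN := one_le_log (hM.trans hMN)
    have hM0 : (0 : ℝ) < M := by positivity
    have hMN' : (M : ℝ) ≤ N := by exact_mod_cast hMN
    have hN0 : (0 : ℝ) < N := by linarith
    set y : ℝ := N / M with hy
    have hy1 : 1 ≤ y := by rw [hy, le_div_iff₀ hM0]; linarith
    have hlog : Real.log N = Real.log M + Real.log y := by
      rw [hy, Real.log_div hN0.ne' hM0.ne']; ring
    have hly : 0 ≤ Real.log y := Real.log_nonneg hy1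
    have h1 : Real.log N ≤ (1 + 1 / η) * y ^ η * Real.log M := by
      have h2 := Real.log_le_rpow_div (by linarith : 0 ≤ y) hη0
      have h3 : 1 ≤ y ^ η := Real.one_le_rpow hy1 hη0.le
      have h4 : (1 + 1 / η) * y ^ η = y ^ η + y ^ η / η := by ring
      rw [h4, hlog]
      nlinarith
    have h2 : Real.log N ^ c ≤ (1 + 1 / η) ^ c * y ^ e * Real.log M ^ c := by
      have h3 := Real.rpow_le_rpow (by linarith) h1 hc0.le
      rw [Real.mul_rpow (by positivity) (by linarith), Real.mul_rpow (by positivity) (by positivity),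
        ← Real.rpow_mul (by positivity), hη, div_mul_cancel₀ _ hc0.ne'] at h3
      exact h3
    have hbc : b = -c := by rw [hc]; ring
    unfold phiS
    rw [hbc, Real.rpow_neg (x := Real.log M) (by linarith), Real.rpow_neg (x := Real.log N) (by linarith)]
    rw [hy, Real.div_rpow hN0.le hM0.le] at h2
    have p1 : 0 < Real.log M ^ c := Real.rpow_pos_of_pos (by linarith) _
    have p2 : 0 < Real.log N ^ c := Real.rpow_pos_of_pos (by linarith) _
    have p3 : 0 < (M : ℝ) ^ e := Real.rpow_pos_of_pos hM0 _
    rw [← div_eq_mul_inv, ← div_eq_mul_inv, ← mul_div_assoc, div_le_div_iff₀ p1 p2]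
    calc (M : ℝ) ^ e * Real.log N ^ c
        ≤ (M : ℝ) ^ e * ((1 + 1 / η) ^ c * ((N : ℝ) ^ e / (M : ℝ) ^ e) * Real.log M ^ c) := by
          gcongr
      _ = _ := by field_simp

theorem phiS_split (a b δ : ℝ) {N : ℕ} (h : 0 < N) :
    phiS a b N = (N : ℝ) ^ δ * phiS (a - δ) b N := by
  unfold phiS
  rw [← mul_assoc, ← Real.rpow_add (by positivity)]
  congr 2; ring

theorem dom_bound (A : ℕ → ℝ) (a b δ c : ℝ) (hA0 : A 0 = 0)
    (hA : Tendsto (fun N => A N / phiS a b N) atTop (nhds c))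
    (hδ : 0 ≤ δ) (h : 0 < a - δ ∨ (a - δ = 0 ∧ 0 ≤ b)) :
    ∃ C : ℝ, 0 < C ∧ ∀ N d : ℕ, 3 ≤ N → 0 < d →
      |A (N / d) / phiS a b N| ≤ C * (d : ℝ) ^ (-δ) := by
  obtain ⟨C1, hC1, hmono⟩ := almost_mono (a - δ) b h
  obtain ⟨C0, hC0⟩ := hA.abs.bddAbove_range
  have hC0' : ∀ N, |A N / phiS a b N| ≤ C0 := fun N => hC0 ⟨N, rfl⟩
  have hC00 : 0 ≤ C0 := (abs_nonneg _).trans (hC0' 0)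
  set H := phiS (a - δ) b 3 with hH
  have hHp : 0 < H := phiS_pos _ _ le_rfl
  set C2 := C0 + (|A 1| + |A 2|) / H + 1 with hC2
  have hC2p : 0 < C2 := by positivity
  have key : ∀ M N : ℕ, 1 ≤ M → M ≤ N → 3 ≤ N →
      |A M| ≤ C2 * C1 * ((M : ℝ) ^ δ * phiS (a - δ) b N) := by
    intro M N hM hMN hN
    have hM1 : (1 : ℝ) ≤ M := by exact_mod_cast hM
    have hMd : 1 ≤ (M : ℝ) ^ δ := Real.one_le_rpow hM1 hδ
    have hpN := phiS_pos (a - δ) b hN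
    by_cases hM3 : 3 ≤ M
    · have h1 := hC0' M
      have hp := phiS_pos a b hM3
      rw [abs_div, abs_of_pos hp, div_le_iff₀ hp, phiS_split a b δ (by omega)] at h1
      have h2 := hmono M N hM3 hMN
      have hpM := phiS_pos (a - δ) b hM3
      calc |A M| ≤ C0 * ((M : ℝ) ^ δ * phiS (a - δ) b M) := h1
        _ ≤ C2 * ((M : ℝ) ^ δ * (C1 * phiS (a - δ) b N)) := by
            gcongr
            rw [hC2]
            have : 0 ≤ (|A 1| + |A 2|) / H := by positivity
            linarith
        _ = _ := by ring
    · have h1 : |A M| ≤ |A 1| + |A 2| := by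
        have : M = 1 ∨ M = 2 := by omega
        rcases this with rfl | rfl
        · linarith [abs_nonneg (A 2)]
        · linarith [abs_nonneg (A 1)]
      have h2 := hmono 3 N le_rfl hN
      calc |A M| ≤ (|A 1| + |A 2|) / H * H := by rw [div_mul_cancel₀ _ hHp.ne']; exact h1
        _ ≤ C2 * (C1 * phiS (a - δ) b N) := by
            gcongr
            rw [hC2]; linarith
        _ = C2 * C1 * (1 * phiS (a - δ) b N) := by ring
        _ ≤ _ := by gcongr
  refine ⟨C2 * C1, by positivity, fun N d hN hd => ?_⟩
  have hp := phiS_pos a b hN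
  have hpN := phiS_pos (a - δ) b hN
  have hd0 : (0 : ℝ) < d := by exact_mod_cast hd
  rcases Nat.eq_zero_or_pos (N / d) with h0 | h0
  · rw [h0, hA0]; simp; positivity
  · have h1 := key (N / d) N h0 (Nat.div_le_self _ _) hN
    rw [abs_div, abs_of_pos hp, div_le_iff₀ hp, phiS_split a b δ (by omega)]
    refine h1.trans ?_
    have h2 : ((N / d : ℕ) : ℝ) ≤ N / d := Nat.cast_div_le
    have h3 : ((N / d : ℕ) : ℝ) ^ δ ≤ (d : ℝ) ^ (-δ) * (N : ℝ) ^ δ := by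
      refine (Real.rpow_le_rpow (by positivity) h2 hδ).trans ?_
      rw [Real.div_rpow (by positivity) hd0.le, Real.rpow_neg hd0.le]
      apply le_of_eq; ring
    calc C2 * C1 * (((N / d : ℕ) : ℝ) ^ δ * phiS (a - δ) b N)
        ≤ C2 * C1 * (((d : ℝ) ^ (-δ) * (N : ℝ) ^ δ) * phiS (a - δ) b N) := by gcongr
      _ = _ := by ring

theorem phiS_ratio (a b : ℝ) (d : ℕ) (hd : 0 < d) :
    Tendsto (fun N : ℕ => phiS a b (N / d) / phiS a b N) atTop (nhds ((d : ℝ) ^ (-a))) := by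
  have hd0 : (0 : ℝ) < d := by exact_mod_cast hd
  have hx : Tendsto (fun N : ℕ => ((N / d : ℕ) : ℝ) / N) atTop (nhds ((d : ℝ)⁻¹)) := by
    have h1 := (tendsto_nat_floor_mul_div_atTop (R := ℝ) (a := (d : ℝ)⁻¹) (by positivity)).comp
      tendsto_natCast_atTop_atTop
    refine h1.congr fun N => ?_
    simp only [Function.comp]
    rw [inv_mul_eq_div, Nat.floor_div_eq_div]
  have hlogN : Tendsto (fun N : ℕ => Real.log N) atTop atTop :=
    Real.tendsto_log_atTop.comp tendsto_natCast_atTop_atTop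
  have hlr : Tendsto (fun N : ℕ => Real.log (N / d : ℕ) / Real.log N) atTop (nhds 1) := by
    have h1 : Tendsto (fun N : ℕ => 1 + Real.log (((N / d : ℕ) : ℝ) / N) / Real.log N)
        atTop (nhds (1 + 0)) :=
      tendsto_const_nhds.add ((hx.log (by positivity)).div_atTop hlogN)
    rw [add_zero] at h1
    refine h1.congr' ?_
    filter_upwards [eventually_ge_atTop (3 * d)] with N hN
    have hN3 : 3 ≤ N := by nlinarith
    have hM3 : 3 ≤ N / d := (Nat.le_div_iff_mul_le hd).2 hN
    have := one_le_log hN3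
    rw [Real.log_div (by positivity) (by positivity)]
    field_simp
    ring
  have h2 := (hx.rpow_const (p := a) (Or.inl (by positivity))).mul
    (hlr.rpow_const (p := b) (Or.inl one_ne_zero))
  rw [Real.one_rpow, mul_one, Real.inv_rpow hd0.le, ← Real.rpow_neg hd0.le] at h2
  refine h2.congr' ?_
  filter_upwards [eventually_ge_atTop (3 * d)] with N hN
  have hN3 : 3 ≤ N := by nlinarith
  have hM3 : 3 ≤ N / d := (Nat.le_div_iff_mul_le hd).2 hN
  have l1 := one_le_log hN3
  have l2 := one_le_log hM3
  unfold phiS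
  rw [Real.div_rpow (by positivity) (by positivity), Real.div_rpow (by linarith) (by linarith),
    div_mul_div_comm]

theorem one_step (A L : ℕ → ℝ) (a b c K γ : ℝ) (q rs : ℕ) (hq : 2 ≤ q) (hA0 : A 0 = 0)
    (hA : Tendsto (fun N => A N / phiS a b N) atTop (nhds c))
    (hab : 0 < a ∨ (a = 0 ∧ 0 ≤ b)) (hK : 0 < K) (hγ : γ < a)
    (hL : ∀ r, rs ≤ r → |L r| ≤ K * (q : ℝ) ^ (γ * r)) :
    Tendsto (fun N => (∑' r, L r * A (N / q ^ r)) / phiS a b N) atTop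
      (nhds (c * ∑' r : ℕ, L r * (q : ℝ) ^ (-(a * r)))) := by
  have hq0 : (0 : ℝ) < q := by exact_mod_cast (by omega : 0 < q)
  have hq1 : (1 : ℝ) < q := by exact_mod_cast (by omega : 1 < q)
  obtain ⟨δ, hδ0, hγδ, hδ⟩ : ∃ δ : ℝ, 0 ≤ δ ∧ γ < δ ∧ (0 < a - δ ∨ (a - δ = 0 ∧ 0 ≤ b)) := by
    rcases hab with h | ⟨h, hb⟩
    · refine ⟨(max γ 0 + a) / 2, ?_, ?_, Or.inl ?_⟩
      · have := le_max_right γ 0; linarith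
      · have := le_max_left γ 0; linarith
      · have : max γ 0 < a := max_lt hγ h
        linarith
    · exact ⟨0, le_rfl, by linarith, Or.inr ⟨by linarith, hb⟩⟩
  obtain ⟨C, hC, hdom⟩ := dom_bound A a b δ c hA0 hA hδ0 hδ
  obtain ⟨K', hK', hL'⟩ : ∃ K' : ℝ, 0 < K' ∧ ∀ r : ℕ, |L r| ≤ K' * (q : ℝ) ^ (γ * r) := by
    have hs : 0 ≤ ∑ r ∈ Finset.range rs, |L r| / (q : ℝ) ^ (γ * r) :=
      Finset.sum_nonneg fun r _ => by positivity
    refine ⟨K + ∑ r ∈ Finset.range rs, |L r| / (q : ℝ) ^ (γ * r), by linarith, fun r => ?_⟩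
    have hp : 0 < (q : ℝ) ^ (γ * r) := by positivity
    by_cases hr : rs ≤ r
    · refine (hL r hr).trans ?_
      gcongr
      linarith
    · have h1 : |L r| / (q : ℝ) ^ (γ * r) ≤ ∑ r ∈ Finset.range rs, |L r| / (q : ℝ) ^ (γ * r) :=
        Finset.single_le_sum (f := fun r : ℕ => |L r| / (q : ℝ) ^ (γ * r))
          (fun r _ => by positivity) (by simpa using hr)
      rw [← div_le_iff₀ hp]
      linarith
  have hpow : ∀ (r : ℕ) (x : ℝ), (((q ^ r : ℕ) : ℝ)) ^ x = (q : ℝ) ^ (x * r) := by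
    intro r x
    rw [Nat.cast_pow, ← Real.rpow_natCast, ← Real.rpow_mul hq0.le, mul_comm]
  have hsum : Summable fun r : ℕ => K' * C * ((q : ℝ) ^ (γ - δ)) ^ r := by
    apply Summable.mul_left
    exact summable_geometric_of_lt_one (by positivity)
      (Real.rpow_lt_one_of_one_lt_of_neg hq1 (by linarith))
  have main := tendsto_tsum_of_dominated_convergence (𝓕 := atTop)
    (f := fun (N r : ℕ) => L r * (A (N / q ^ r) / phiS a b N))
    (g := fun r : ℕ => L r * (c * (q : ℝ) ^ (-(a * r)))) hsum ?_ ?_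
  · rw [← tsum_mul_left]
    convert main using 2
    · rw [← tsum_div_const]
      simp only [mul_div_assoc]
    · congr 1; ext r; ring
  · intro r
    apply Tendsto.const_mul
    have hdp : 0 < q ^ r := pow_pos (by omega) r
    have h1 := phiS_ratio a b (q ^ r) hdp
    have h2 := (hA.comp (Nat.tendsto_div_const_atTop hdp.ne')).mul h1
    rw [hpow, neg_mul] at h2
    refine h2.congr' ?_
    filter_upwards [eventually_ge_atTop (3 * q ^ r)] with N hN
    have hM3 : 3 ≤ N / q ^ r := (Nat.le_div_iff_mul_le hdp).2 hN
    have := (phiS_pos a b hM3).ne'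
    simp only [Function.comp]
    field_simp
  · filter_upwards [eventually_ge_atTop 3] with N hN r
    have h1 := hdom N (q ^ r) hN (pow_pos (by omega) r)
    rw [hpow] at h1
    rw [Real.norm_eq_abs, abs_mul]
    calc |L r| * |A (N / q ^ r) / phiS a b N|
        ≤ (K' * (q : ℝ) ^ (γ * r)) * (C * (q : ℝ) ^ (-δ * r)) := by
          gcongr
          exact hL' r
      _ = K' * C * ((q : ℝ) ^ (γ * r) * (q : ℝ) ^ (-δ * r)) := by ring
      _ = K' * C * ((q : ℝ) ^ (γ - δ)) ^ r := by
          rw [← Real.rpow_add hq0, ← Real.rpow_natCast, ← Real.rpow_mul hq0.le]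
          congr 2; ring

/-- Theorem 3 of the paper: renormalization with a composite scaling
`∏ p_i^{m_i}` tends to the product of the one-prime characteristic series. -/
theorem renormalization_composite_scaling
    (f : ℕ → ℝ) (a1 b1 a2 b2 : ℝ) (n : ℕ) (p : Fin n → ℕ) (m : Fin n → ℕ)
    (hf : IsMultiplicativeFn f) (hp : ∀ i, (p i).Prime)
    (hdist : Function.Injective p)
    (hadm : AdmissibleParams a1 b1 a2 b2)
    (hclass : InUniversalityClass f a1 b1 a2 b2)
    (K γ : ℝ) (hK : 0 < K) (hγ : γ < a1) (rstar : ℕ)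
    (hL : ∀ i : Fin n, ∀ r : ℕ, rstar ≤ r →
      |charL f (p i) (m i) r| ≤ K * (p i : ℝ) ^ (γ * r)) :
    Tendsto (fun N : ℕ =>
        (∑ k ∈ Finset.Icc 1 N, f (k * ∏ i, p i ^ m i)) /
          (∑ k ∈ Finset.Icc 1 N, f k))
      atTop
      (nhds (∏ i, ∑' r : ℕ, charL f (p i) (m i) r * (p i : ℝ) ^ (-(a1 * r)))) := by
  obtain ⟨Fc, C, hFc, hC, hT, -⟩ := hclass
  have hbase : Tendsto (fun N : ℕ => (∑ k ∈ Finset.Icc 1 N, f k) / phiS a1 b1 N) atTop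
      (nhds Fc) := by
    have h1 := hT.const_mul Fc
    rw [mul_one] at h1
    refine h1.congr fun N => ?_
    unfold phiS
    rw [mul_assoc, div_mul_eq_div_div_swap, mul_div_cancel₀ _ hFc.ne']
  have hind : ∀ S : Finset (Fin n),
      Tendsto (fun N : ℕ => (∑ k ∈ Finset.Icc 1 N, f (k * ∏ i ∈ S, p i ^ m i)) / phiS a1 b1 N)
        atTop (nhds (Fc * ∏ i ∈ S, ∑' r : ℕ, charL f (p i) (m i) r * (p i : ℝ) ^ (-(a1 * r)))) := by
    intro S
    induction S using Finset.induction_on with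
    | empty => simpa using hbase
    | insert i S hi ih =>
      have h1 := one_step (fun N => ∑ k ∈ Finset.Icc 1 N, f (k * ∏ i ∈ S, p i ^ m i))
        (charL f (p i) (m i)) a1 b1 _ K γ (p i) rstar (hp i).two_le (by simp) ih hadm.1 hK hγ
        (hL i)
      rw [Finset.prod_insert hi, Finset.prod_insert hi]
      have hM : 0 < ∏ i ∈ S, p i ^ m i := Finset.prod_pos fun j _ => pow_pos (hp j).pos _
      have hcop : Nat.Coprime (p i) (∏ i ∈ S, p i ^ m i) := by
        refine Nat.Coprime.prod_right fun j hj => Nat.Coprime.pow_right _ ?_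
        refine (Nat.coprime_primes (hp i) (hp j)).2 fun h => hi ?_
        rw [hdist h]; exact hj
      simp only [sum_id f hf (p i) (m i) _ _ (hp i) hM hcop]
      convert h1 using 2
      ring
  have h2 := (hind Finset.univ).div hbase hFc.ne'
  rw [mul_div_cancel_left₀ _ hFc.ne'] at h2
  refine h2.congr' ?_
  filter_upwards [eventually_ge_atTop 3] with N hN
  have := (phiS_pos a1 b1 hN).ne'
  simp only [Pi.div_apply]
  rw [div_div_div_cancel_right₀ this]
end

section
/- Let f be a multiplicative arithmetic function belonging to the universality class ℬ{N^{a1}(log N)^{b1}; N^{−a2}(log N)^{−b2}} with admissible parameters, let p be a prime and m ≥ 0 an integer, suppose L_r(f;p^m) ≥ 0 for all r ≥ 0, and suppose the limit lim_{N→∞} ℛ₁(f;N,p^m) exists, where ℛ₁(f;N,p^m) = ∑_{r=0}^{⌊log_p N⌋−1} L_r(f;p^m)·p^{−a1·r}·(1 − r/log_p N)^{b1}. Assume one of the following holds: (1) a1 = a2 = 0 and b1 ≥ b2 > 0; (2) 0 < a2 < a1 and 0 ≤ b2 ≤ b1, or 0 = a2 < a1 and 0 < b2 ≤ b1; (3)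 0 < a2 < a1, b1 < b2 and b1 < 0, or 0 = a2 < a1 and b1 < 0 < b2. Then for every function E on the positive integers for which there exists C > 0 with |E(n)| ≤ C·n^{−a2}(log n)^{−b2} for all n ≥ 2, the error sum ℛ₂(N) = ∑_{r=0}^{⌊log_p N⌋−1} L_r(f;p^m)·p^{−a1·r}·(1 − r/log_p N)^{b1}·E(⌊N/p^r⌋) tends to 0 as N → ∞. -/
open Filter

theorem aux_E_tendsto (a2 b2 : ℝ) (h : 0 < a2 ∨ (a2 = 0 ∧ 0 < b2)) (E : ℕ → ℝ) (C : ℝ)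
    (hE : ∀ n : ℕ, 2 ≤ n → |E n| ≤ C * (n : ℝ) ^ (-a2) * Real.log n ^ (-b2)) :
    Tendsto E atTop (nhds 0) := by
  have key : Tendsto (fun x : ℝ => x ^ (-a2) * Real.log x ^ (-b2)) atTop (nhds 0) := by
    rcases h with h | ⟨h, hb⟩
    · have h1 := (isLittleO_log_rpow_rpow_atTop (-b2) h).tendsto_div_nhds_zero
      refine h1.congr' ?_
      filter_upwards [eventually_gt_atTop 0] with x hx
      rw [Real.rpow_neg hx.le, div_eq_mul_inv, mul_comm]
    · subst h
      have := (tendsto_rpow_neg_atTop hb).comp Real.tendsto_log_atTop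
      simpa [Function.comp_def] using this
  have k2 := (key.comp tendsto_natCast_atTop_atTop).const_mul C
  rw [mul_zero] at k2
  rw [tendsto_zero_iff_abs_tendsto_zero]
  refine squeeze_zero' (Eventually.of_forall fun n => abs_nonneg _) ?_ k2
  filter_upwards [eventually_ge_atTop 2] with n hn
  simpa [Function.comp_def, mul_assoc] using hE n hn

theorem aux_nlog_tendsto (p : ℕ) (hp : 2 ≤ p) : Tendsto (fun N : ℕ => Nat.log p N) atTop atTop := by
  refine tendsto_atTop.2 fun b => ?_
  filter_upwards [eventually_ge_atTop (p ^ b)] with N hN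
  exact Nat.le_log_of_pow_le (by omega) hN

theorem aux_logb_ge (p N : ℕ) (hp : 2 ≤ p) (hN : N ≠ 0) : (Nat.log p N : ℝ) ≤ Real.logb p N := by
  have h1 : (1 : ℝ) < p := by exact_mod_cast (by omega : 1 < p)
  rw [Real.le_logb_iff_rpow_le h1 (by exact_mod_cast Nat.pos_of_ne_zero hN)]
  rw [Real.rpow_natCast]
  exact_mod_cast Nat.pow_log_le_self p hN

theorem aux_logb_lt (p N : ℕ) (hp : 2 ≤ p) (hN : N ≠ 0) : Real.logb p N < (Nat.log p N : ℝ) + 1 := by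
  have h1 : (1 : ℝ) < p := by exact_mod_cast (by omega : 1 < p)
  rw [Real.logb_lt_iff_lt_rpow h1 (by exact_mod_cast Nat.pos_of_ne_zero hN)]
  have : ((Nat.log p N : ℝ) + 1) = ((Nat.log p N + 1 : ℕ) : ℝ) := by push_cast; ring
  rw [this, Real.rpow_natCast]
  exact_mod_cast Nat.lt_pow_succ_log_self (by omega) N

theorem aux_base_pos (p N r : ℕ) (hp : 2 ≤ p) (hr : r < Nat.log p N) :
    0 < 1 - (r : ℝ) / Real.logb p N := by
  have hN : N ≠ 0 := by rintro rfl; simp at hr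
  have h1 := aux_logb_ge p N hp hN
  have h2 : (r : ℝ) < Nat.log p N := by exact_mod_cast hr
  have h3 : (0 : ℝ) ≤ r := Nat.cast_nonneg r
  rw [sub_pos, div_lt_one (by linarith)]
  linarith

theorem aux_main (g : ℕ → ℝ) (b1 : ℝ) (p : ℕ) (hp : 2 ≤ p) (hg : ∀ r, 0 ≤ g r) (l : ℝ)
    (hR1 : Tendsto (fun N : ℕ => ∑ r ∈ Finset.range (Nat.log p N),
      g r * (1 - (r : ℝ) / Real.logb p N) ^ b1) atTop (nhds l))
    (hend : ∀ K j : ℕ, j < K → Tendsto (fun N : ℕ => g (Nat.log p N - K + j) *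
      (1 - ((Nat.log p N - K + j : ℕ) : ℝ) / Real.logb p N) ^ b1) atTop (nhds 0))
    (E : ℕ → ℝ) (hE : Tendsto E atTop (nhds 0)) :
    Tendsto (fun N : ℕ => ∑ r ∈ Finset.range (Nat.log p N),
      g r * (1 - (r : ℝ) / Real.logb p N) ^ b1 * E (N / p ^ r)) atTop (nhds 0) := by
  have hEa : Tendsto (fun n => |E n|) atTop (nhds 0) := by
    simpa using hE.abs
  obtain ⟨M, hM⟩ := hEa.bddAbove_range
  have hM' : ∀ n, |E n| ≤ M := fun n => hM ⟨n, rfl⟩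
  have hM0 : 0 ≤ M := (abs_nonneg _).trans (hM' 0)
  rw [Metric.tendsto_atTop']
  intro ε hε
  have hl : 0 < |l| + 1 := by positivity
  have hε' : 0 < ε / (2 * (|l| + 1)) := by positivity
  obtain ⟨n0, hn0⟩ := eventually_atTop.1 (hEa.eventually (gt_mem_nhds hε'))
  set K := n0 with hK
  have hsum : Tendsto (fun N : ℕ => M * ∑ j ∈ Finset.range K, g (Nat.log p N - K + j) *
      (1 - ((Nat.log p N - K + j : ℕ) : ℝ) / Real.logb p N) ^ b1) atTop (nhds 0) := by
    have := (tendsto_finsetSum (Finset.range K)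
      (fun j hj => hend K j (Finset.mem_range.1 hj))).const_mul M
    simpa using this
  have e1 := hsum.eventually (gt_mem_nhds (half_pos hε))
  have e2 := hR1.eventually (gt_mem_nhds (lt_of_le_of_lt (le_abs_self l) (lt_add_one _)))
  have e3 := (aux_nlog_tendsto p hp).eventually (eventually_ge_atTop K)
  obtain ⟨N0, hN0⟩ := eventually_atTop.1 (e1.and (e2.and e3))
  refine ⟨N0, fun N hN => ?_⟩
  obtain ⟨h1, h2, h3⟩ := hN0 N hN.le
  rw [Real.dist_eq, sub_zero]
  have hw : ∀ r < Nat.log p N, 0 ≤ g r * (1 - (r : ℝ) / Real.logb p N) ^ b1 := fun r hr =>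
    mul_nonneg (hg r) (Real.rpow_nonneg (aux_base_pos p N r hp hr).le _)
  set A : ℕ → ℝ := fun r => g r * (1 - (r : ℝ) / Real.logb p N) ^ b1 with hA
  change |∑ r ∈ Finset.range (Nat.log p N), A r * E (N / p ^ r)| < ε
  change M * ∑ j ∈ Finset.range K, A (Nat.log p N - K + j) < ε / 2 at h1
  change ∑ r ∈ Finset.range (Nat.log p N), A r < |l| + 1 at h2
  change ∀ r < Nat.log p N, 0 ≤ A r at hw
  obtain ⟨s, hs⟩ : ∃ s, Nat.log p N = s + K := ⟨Nat.log p N - K, by omega⟩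
  have hNne : N ≠ 0 ∨ Nat.log p N = 0 := by
    by_cases h : N = 0
    · right; simp [h]
    · left; exact h
  have hEr : ∀ r < s, |E (N / p ^ r)| ≤ ε / (2 * (|l| + 1)) := by
    intro r hr
    have hN1 : N ≠ 0 := by
      rcases hNne with h | h
      · exact h
      · omega
    apply (hn0 _ _).le
    have : p ^ (r + K) ≤ N :=
      (Nat.pow_le_pow_right (by omega) (by omega)).trans (Nat.pow_log_le_self p hN1)
    have h5 : p ^ K ≤ N / p ^ r := by
      rw [Nat.le_div_iff_mul_le (by positivity), ← pow_add, add_comm]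
      exact this
    exact (Nat.lt_pow_self (by omega)).le.trans h5
  rw [hs] at h1 h2 hw ⊢
  rw [Nat.add_sub_cancel] at h1
  have hb := Finset.sum_range_add (fun r => A r) s K
  calc |∑ r ∈ Finset.range (s + K), A r * E (N / p ^ r)|
      ≤ ∑ r ∈ Finset.range (s + K), A r * |E (N / p ^ r)| := by
        refine (Finset.abs_sum_le_sum_abs _ _).trans (Finset.sum_le_sum fun r hr => ?_)
        rw [abs_mul, abs_of_nonneg (hw r (Finset.mem_range.1 hr))]
    _ = ∑ r ∈ Finset.range s, A r * |E (N / p ^ r)|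
        + ∑ j ∈ Finset.range K, A (s + j) * |E (N / p ^ (s + j))| := Finset.sum_range_add _ _ _
    _ ≤ ∑ r ∈ Finset.range s, A r * (ε / (2 * (|l| + 1)))
        + ∑ j ∈ Finset.range K, A (s + j) * M := by
        refine add_le_add (Finset.sum_le_sum fun r hr => ?_) (Finset.sum_le_sum fun r hr => ?_)
        · have := Finset.mem_range.1 hr
          exact mul_le_mul_of_nonneg_left (hEr r this) (hw r (by omega))
        · have := Finset.mem_range.1 hr
          exact mul_le_mul_of_nonneg_left (hM' _) (hw _ (by omega))
    _ < ε := by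
        rw [← Finset.sum_mul, ← Finset.sum_mul]
        have h6 : ∑ r ∈ Finset.range s, A r ≤ |l| + 1 := by
          have : 0 ≤ ∑ j ∈ Finset.range K, A (s + j) := Finset.sum_nonneg fun r hr => by
            have := Finset.mem_range.1 hr
            exact hw _ (by omega)
          linarith
        have h7 := mul_le_mul_of_nonneg_right h6 hε'.le
        have h8 : (|l| + 1) * (ε / (2 * (|l| + 1))) = ε / 2 := by field_simp
        linarith

theorem aux_idx (p K j : ℕ) (hp : 2 ≤ p) : Tendsto (fun N : ℕ => Nat.log p N - K + j) atTop atTop := by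
  have h := aux_nlog_tendsto p hp
  refine tendsto_atTop.2 fun b => ?_
  filter_upwards [h.eventually (eventually_ge_atTop (b + K))] with N hN
  omega

theorem aux_end_nonneg (g : ℕ → ℝ) (b1 : ℝ) (hb1 : 0 ≤ b1) (p : ℕ) (hp : 2 ≤ p)
    (hg : ∀ r, 0 ≤ g r) (l : ℝ)
    (hR1 : Tendsto (fun N : ℕ => ∑ r ∈ Finset.range (Nat.log p N),
      g r * (1 - (r : ℝ) / Real.logb p N) ^ b1) atTop (nhds l)) (K j : ℕ) (hj : j < K) :
    Tendsto (fun N : ℕ => g (Nat.log p N - K + j) *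
      (1 - ((Nat.log p N - K + j : ℕ) : ℝ) / Real.logb p N) ^ b1) atTop (nhds 0) := by
  have hp1 : (1 : ℝ) < p := by exact_mod_cast (by omega : 1 < p)
  have hlog : Tendsto (fun N : ℕ => Real.logb p N) atTop atTop :=
    (Real.tendsto_logb_atTop hp1).comp tendsto_natCast_atTop_atTop
  have hsum : Summable g := by
    refine summable_of_sum_range_le (c := l) hg fun R => ?_
    have ht : Tendsto (fun N : ℕ => ∑ r ∈ Finset.range R,
        g r * (1 - (r : ℝ) / Real.logb p N) ^ b1) atTop (nhds (∑ r ∈ Finset.range R, g r)) := by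
      refine tendsto_finsetSum _ fun r _ => ?_
      have h1 : Tendsto (fun N : ℕ => 1 - (r : ℝ) / Real.logb p N) atTop (nhds 1) := by
        simpa using (hlog.const_div_atTop (r : ℝ)).const_sub 1
      have h2 := (h1.rpow_const (p := b1) (Or.inl one_ne_zero)).const_mul (g r)
      simpa using h2
    refine le_of_tendsto_of_tendsto ht hR1 ?_
    filter_upwards [(aux_nlog_tendsto p hp).eventually (eventually_ge_atTop R)] with N hN
    refine Finset.sum_le_sum_of_subset_of_nonneg (Finset.range_mono hN) fun r hr _ => ?_
    exact mul_nonneg (hg r)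
      (Real.rpow_nonneg (aux_base_pos p N r hp (Finset.mem_range.1 hr)).le _)
  have h0 := hsum.tendsto_atTop_zero.comp (aux_idx p K j hp)
  have hlt : ∀ᶠ N : ℕ in atTop, Nat.log p N - K + j < Nat.log p N := by
    filter_upwards [(aux_nlog_tendsto p hp).eventually (eventually_ge_atTop K)] with N hN
    omega
  refine squeeze_zero' ?_ ?_ h0
  · filter_upwards [hlt] with N hN
    exact mul_nonneg (hg _) (Real.rpow_nonneg (aux_base_pos p N _ hp hN).le _)
  · filter_upwards [hlt] with N hN
    refine mul_le_of_le_one_right (hg _)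
      (Real.rpow_le_one (aux_base_pos p N _ hp hN).le ?_ hb1)
    have hN0 : N ≠ 0 := by rintro rfl; simp at hN
    have h1 := aux_logb_ge p N hp hN0
    have : 0 ≤ Real.logb p N := (Nat.cast_nonneg _).trans h1
    have : 0 ≤ ((Nat.log p N - K + j : ℕ) : ℝ) / Real.logb p N := by positivity
    linarith

theorem aux_u_neg (g : ℕ → ℝ) (b1 : ℝ) (hb1 : b1 < 0) (p : ℕ) (hp : 2 ≤ p)
    (hg : ∀ r, 0 ≤ g r) (l : ℝ)
    (hR1 : Tendsto (fun N : ℕ => ∑ r ∈ Finset.range (Nat.log p N),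
      g r * (1 - (r : ℝ) / Real.logb p N) ^ b1) atTop (nhds l)) :
    Tendsto (fun t : ℕ => g t * ((t : ℝ) + 1) ^ (-b1)) atTop (nhds 0) := by
  have hp1 : (1 : ℝ) < p := by exact_mod_cast (by omega : 1 < p)
  have hp0 : (0 : ℝ) < p := by linarith
  have hlp : 0 < Real.log p := Real.log_pos hp1
  have hP : Tendsto (fun t : ℕ => p ^ (t + 1)) atTop atTop :=
    (tendsto_pow_atTop_atTop_of_one_lt (by omega : 1 < p)).comp (tendsto_add_atTop_nat 1)
  have hP1 : Tendsto (fun t : ℕ => p ^ (t + 1) - 1) atTop atTop :=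
    (tendsto_sub_atTop_nat 1).comp hP
  have hlam : Tendsto (fun t : ℕ => 1 + (((t : ℝ) + 1) - Real.logb p ((p ^ (t + 1) - 1 : ℕ) : ℝ)))
      atTop (nhds 1) := by
    have h1 := ((Real.tendsto_log_nat_add_one_sub_log.comp hP1).div_const (Real.log p)).const_add 1
    rw [zero_div, add_zero] at h1
    refine h1.congr fun t => ?_
    have hpos : 1 ≤ p ^ (t + 1) := Nat.one_le_pow _ _ (by omega)
    simp only [Function.comp, Real.logb]
    have e : ((p ^ (t + 1) - 1 : ℕ) : ℝ) + 1 = (p : ℝ) ^ (t + 1) := by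
      have : p ^ (t + 1) - 1 + 1 = p ^ (t + 1) := by omega
      exact_mod_cast this
    rw [e, Real.log_pow]
    push_cast
    field_simp
  have hlim : Tendsto (fun t : ℕ =>
      (∑ r ∈ Finset.range (Nat.log p (p ^ (t + 1))),
        g r * (1 - (r : ℝ) / Real.logb p ((p ^ (t + 1) : ℕ) : ℝ)) ^ b1) -
      (1 + (((t : ℝ) + 1) - Real.logb p ((p ^ (t + 1) - 1 : ℕ) : ℝ))) ^ b1 *
      (∑ r ∈ Finset.range (Nat.log p (p ^ (t + 1) - 1)),
        g r * (1 - (r : ℝ) / Real.logb p ((p ^ (t + 1) - 1 : ℕ) : ℝ)) ^ b1)) atTop (nhds 0) := by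
    have := (hR1.comp hP).sub
      ((hlam.rpow_const (p := b1) (Or.inl one_ne_zero)).mul (hR1.comp hP1))
    simpa [Function.comp_def] using this
  refine squeeze_zero' (Eventually.of_forall fun t => mul_nonneg (hg t) (by positivity)) ?_ hlim
  filter_upwards [eventually_ge_atTop 1] with t ht
  have hpt : p ^ t < p ^ (t + 1) := Nat.pow_lt_pow_right (by omega) (by omega)
  have hpt0 : 0 < p ^ t := by positivity
  set N := p ^ (t + 1) - 1 with hNdef
  have hN0 : N ≠ 0 := by omega
  have hlogN : Nat.log p N = t := by
    apply Nat.log_eq_of_pow_le_of_lt_pow <;> omega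
  have hlogbP : Real.logb p ((p ^ (t + 1) : ℕ) : ℝ) = (t : ℝ) + 1 := by
    push_cast
    rw [Real.logb_pow, Real.logb_self_eq_one hp1]
    push_cast; ring
  rw [Nat.log_pow (by omega), hlogN, hlogbP, Finset.sum_range_succ, Finset.mul_sum]
  have hT1 := aux_logb_ge p N hp hN0
  have hT2 := aux_logb_lt p N hp hN0
  rw [hlogN] at hT1 hT2
  set T := Real.logb p (N : ℝ) with hT
  have ht1 : (1 : ℝ) ≤ t := by exact_mod_cast ht
  have hlast : (1 - (t : ℝ) / ((t : ℝ) + 1)) ^ b1 = ((t : ℝ) + 1) ^ (-b1) := by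
    have : 1 - (t : ℝ) / ((t : ℝ) + 1) = ((t : ℝ) + 1)⁻¹ := by field_simp; ring
    rw [this, Real.inv_rpow (by positivity), Real.rpow_neg (by positivity)]
  rw [hlast]
  have hle : ∑ r ∈ Finset.range t, (1 + ((t : ℝ) + 1 - T)) ^ b1 * (g r * (1 - (r : ℝ) / T) ^ b1)
      ≤ ∑ r ∈ Finset.range t, g r * (1 - (r : ℝ) / ((t : ℝ) + 1)) ^ b1 := by
    refine Finset.sum_le_sum fun r hr => ?_
    have hrt : (r : ℝ) + 1 ≤ t := by exact_mod_cast Finset.mem_range.1 hr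
    have hr0 : (0 : ℝ) ≤ r := Nat.cast_nonneg r
    have hlam0 : 0 < 1 + ((t : ℝ) + 1 - T) := by linarith
    have hT0 : 0 < T := by linarith
    have hb : 0 < 1 - (r : ℝ) / T := by
      rw [sub_pos, div_lt_one hT0]; linarith
    have hb' : 0 < 1 - (r : ℝ) / ((t : ℝ) + 1) := by
      rw [sub_pos, div_lt_one (by linarith)]; linarith
    rw [mul_left_comm, ← Real.mul_rpow hlam0.le hb.le]
    refine mul_le_mul_of_nonneg_left ?_ (hg r)
    refine Real.rpow_le_rpow_of_nonpos hb' ?_ hb1.le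
    have e1 : 1 - (r : ℝ) / ((t : ℝ) + 1) = ((t : ℝ) + 1 - r) / ((t : ℝ) + 1) := by field_simp
    have e2 : (1 + ((t : ℝ) + 1 - T)) * (1 - (r : ℝ) / T)
        = ((1 + ((t : ℝ) + 1 - T)) * (T - r)) / T := by field_simp
    rw [e1, e2]
    refine div_le_div₀ ?_ ?_ hT0 hT2.le
    · exact mul_nonneg hlam0.le (by linarith)
    · nlinarith
  linarith

theorem aux_end_neg (g : ℕ → ℝ) (b1 : ℝ) (hb1 : b1 < 0) (p : ℕ) (hp : 2 ≤ p)
    (hg : ∀ r, 0 ≤ g r) (l : ℝ)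
    (hR1 : Tendsto (fun N : ℕ => ∑ r ∈ Finset.range (Nat.log p N),
      g r * (1 - (r : ℝ) / Real.logb p N) ^ b1) atTop (nhds l)) (K j : ℕ) (hj : j < K) :
    Tendsto (fun N : ℕ => g (Nat.log p N - K + j) *
      (1 - ((Nat.log p N - K + j : ℕ) : ℝ) / Real.logb p N) ^ b1) atTop (nhds 0) := by
  have h0 := ((aux_u_neg g b1 hb1 p hp hg l hR1).comp (aux_idx p K j hp)).mul_const
    (((K : ℝ) + 1) ^ (-b1))
  rw [zero_mul] at h0
  have hK : ∀ᶠ N : ℕ in atTop, K ≤ Nat.log p N :=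
    (aux_nlog_tendsto p hp).eventually (eventually_ge_atTop K)
  refine squeeze_zero' ?_ ?_ h0
  · filter_upwards [hK] with N hN
    exact mul_nonneg (hg _) (Real.rpow_nonneg (aux_base_pos p N _ hp (by omega)).le _)
  · filter_upwards [hK] with N hN
    simp only [Function.comp]
    have hN0 : N ≠ 0 := by rintro rfl; simp at hN; omega
    have h1 := aux_logb_ge p N hp hN0
    have h2 := aux_logb_lt p N hp hN0
    have hr1 : Nat.log p N - K + j + 1 ≤ Nat.log p N := by omega
    have hr2 : Nat.log p N ≤ Nat.log p N - K + j + K := by omega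
    generalize Nat.log p N - K + j = r at *
    have hr1' : (r : ℝ) + 1 ≤ Nat.log p N := by exact_mod_cast hr1
    have hr2' : (Nat.log p N : ℝ) ≤ r + K := by exact_mod_cast hr2
    have hr0 : (0 : ℝ) ≤ r := Nat.cast_nonneg r
    have hK0 : (0 : ℝ) ≤ K := Nat.cast_nonneg K
    set T := Real.logb p (N : ℝ)
    have hT : 0 < T := by linarith
    rw [mul_assoc, ← Real.mul_rpow (by positivity) (by positivity)]
    refine mul_le_mul_of_nonneg_left ?_ (hg r)
    rw [Real.rpow_neg (by positivity), ← Real.inv_rpow (by positivity)]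
    refine Real.rpow_le_rpow_of_nonpos (by positivity) ?_ hb1.le
    have e1 : 1 - (r : ℝ) / T = (T - r) / T := by field_simp
    rw [e1, inv_eq_one_div]
    refine div_le_div₀ (by linarith) (by linarith) hT ?_
    nlinarith

/-- Proposition 1 of the paper: with nonnegative characteristic
functions and a convergent main sum `ℛ₁`, in each of the three listed parameter
regimes the error sum `ℛ₂` tends to `0`. -/
theorem error_sum_vanishes_of_nonneg_charL
    (f : ℕ → ℝ) (a1 b1 a2 b2 : ℝ) (p m : ℕ)
    (hf : IsMultiplicativeFn f) (hp : p.Prime)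
    (hadm : AdmissibleParams a1 b1 a2 b2)
    (hclass : InUniversalityClass f a1 b1 a2 b2)
    (hLpos : ∀ r : ℕ, 0 ≤ charL f p m r)
    (hR1 : ∃ l : ℝ, Tendsto (fun N : ℕ =>
        ∑ r ∈ Finset.range (Nat.log p N),
          charL f p m r * (p : ℝ) ^ (-(a1 * r)) *
            (1 - (r : ℝ) / Real.logb p N) ^ b1)
      atTop (nhds l))
    (hcases :
      (a1 = 0 ∧ a2 = 0 ∧ 0 < b2 ∧ b2 ≤ b1) ∨
      ((0 < a2 ∧ a2 < a1 ∧ 0 ≤ b2 ∧ b2 ≤ b1) ∨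
        (a2 = 0 ∧ 0 < a1 ∧ 0 < b2 ∧ b2 ≤ b1)) ∨
      ((0 < a2 ∧ a2 < a1 ∧ b1 < b2 ∧ b1 < 0) ∨
        (a2 = 0 ∧ 0 < a1 ∧ b1 < 0 ∧ 0 < b2))) :
    ∀ E : ℕ → ℝ,
      (∃ C : ℝ, 0 < C ∧ ∀ n : ℕ, 2 ≤ n →
        |E n| ≤ C * (n : ℝ) ^ (-a2) * Real.log n ^ (-b2)) →
      Tendsto (fun N : ℕ =>
          ∑ r ∈ Finset.range (Nat.log p N),
            charL f p m r * (p : ℝ) ^ (-(a1 * r)) *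
              (1 - (r : ℝ) / Real.logb p N) ^ b1 * E (N / p ^ r))
        atTop (nhds 0) := by
  intro E ⟨C, _, hE⟩
  obtain ⟨l, hl⟩ := hR1
  have hg : ∀ r : ℕ, 0 ≤ charL f p m r * (p : ℝ) ^ (-(a1 * r)) := fun r =>
    mul_nonneg (hLpos r) (Real.rpow_nonneg (Nat.cast_nonneg p) _)
  refine aux_main (fun r => charL f p m r * (p : ℝ) ^ (-(a1 * r))) b1 p hp.two_le hg l hl ?_ E
    (aux_E_tendsto a2 b2 hadm.2 E C hE)
  intro K j hj
  rcases le_or_gt 0 b1 with hb | hb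
  · exact aux_end_nonneg (fun r => charL f p m r * (p : ℝ) ^ (-(a1 * r))) b1 hb p hp.two_le hg l hl
      K j hj
  · exact aux_end_neg (fun r => charL f p m r * (p : ℝ) ^ (-(a1 * r))) b1 hb p hp.two_le hg l hl
      K j hj
end

section
/- Let f be a multiplicative arithmetic function belonging to the universality class ℬ{N^{a1}(log N)^{b1}; G2(N)} with a1 ≥ 0 and b1 ≥ 0, let p be a prime and m ≥ 0 an integer, and suppose there exist real numbers K > 0 and γ < a1 and an integer r* ≥ 0 such that |L_r(f;p^m)| ≤ K·p^{γr} for all r ≥ r*. Then ℛ₁(f;N,p^m) = ∑_{r=0}^{⌊log_p N⌋} L_r(f;p^m)·p^{−a1·r}·(1 − r/log_p N)^{b1} tends to ∑_{r=0}^{∞} L_r(f;p^m)·p^{−a1·r} as N → ∞ (the latter series being convergent). -/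
open Filter

/-- `f` belongs to the universality class `ℬ{N^{a1}(log N)^{b1}; G2(N)}`
with a general error function `G2`. -/
def InUniversalityClassG (f : ℕ → ℝ) (a1 b1 : ℝ) (G2 : ℕ → ℝ) : Prop :=
  ∃ Fc C : ℝ, 0 < Fc ∧ 0 < C ∧
    Tendsto (fun N : ℕ =>
        (∑ k ∈ Finset.Icc 1 N, f k) / (Fc * (N : ℝ) ^ a1 * Real.log N ^ b1))
      atTop (nhds 1) ∧
    ∀ᶠ N : ℕ in atTop,
      |(∑ k ∈ Finset.Icc 1 N, f k) / (Fc * (N : ℝ) ^ a1 * Real.log N ^ b1) - 1|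
        < C * G2 N

/-- Lemma 1 of the paper: for `a1 ≥ 0`, `b1 ≥ 0`, the main sum
`ℛ₁(f;N,p^m)` converges to `∑_{r=0}^{∞} L_r(f;p^m) p^{-a1 r}`. -/
theorem main_sum_limit_nonneg_b1
    (f : ℕ → ℝ) (a1 b1 : ℝ) (G2 : ℕ → ℝ) (p m : ℕ)
    (hf : IsMultiplicativeFn f) (hp : p.Prime)
    (ha1 : 0 ≤ a1) (hb1 : 0 ≤ b1)
    (hG2pos : ∀ N : ℕ, 0 < G2 N) (hG2anti : Antitone G2)
    (hclass : InUniversalityClassG f a1 b1 G2)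
    (K γ : ℝ) (hK : 0 < K) (hγ : γ < a1) (rstar : ℕ)
    (hL : ∀ r : ℕ, rstar ≤ r → |charL f p m r| ≤ K * (p : ℝ) ^ (γ * r)) :
    Summable (fun r : ℕ => charL f p m r * (p : ℝ) ^ (-(a1 * r))) ∧
    Tendsto (fun N : ℕ =>
        ∑ r ∈ Finset.range (Nat.log p N + 1),
          charL f p m r * (p : ℝ) ^ (-(a1 * r)) *
            (1 - (r : ℝ) / Real.logb p N) ^ b1)
      atTop (nhds (∑' r : ℕ, charL f p m r * (p : ℝ) ^ (-(a1 * r)))) := by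
  have hp1 : (1 : ℝ) < p := by exact_mod_cast hp.one_lt
  have hp0 : (0 : ℝ) < p := by linarith
  have hsum : Summable (fun r : ℕ => charL f p m r * (p : ℝ) ^ (-(a1 * r))) := by
    have hg : Summable (fun r : ℕ => K * ((p : ℝ) ^ (γ - a1)) ^ r) := by
      apply Summable.mul_left
      apply summable_geometric_of_lt_one (by positivity)
      exact Real.rpow_lt_one_of_one_lt_of_neg hp1 (by linarith)
    refine Summable.of_norm_bounded_eventually_nat hg ?_
    filter_upwards [eventually_ge_atTop rstar] with r hr
    rw [Real.norm_eq_abs, abs_mul, abs_of_pos (Real.rpow_pos_of_pos hp0 (-(a1 * r)))]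
    calc |charL f p m r| * (p : ℝ) ^ (-(a1 * r))
        ≤ K * (p : ℝ) ^ (γ * r) * (p : ℝ) ^ (-(a1 * r)) :=
          mul_le_mul_of_nonneg_right (hL r hr) (Real.rpow_pos_of_pos hp0 _).le
      _ = K * ((p : ℝ) ^ (γ - a1)) ^ r := by
          rw [mul_assoc, ← Real.rpow_add hp0, ← Real.rpow_natCast, ← Real.rpow_mul hp0.le]
          congr 2
          ring
  refine ⟨hsum, ?_⟩
  have hlog : Tendsto (fun N : ℕ => Real.logb p N) atTop atTop :=
    (Real.tendsto_logb_atTop hp1).comp tendsto_natCast_atTop_atTop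
  have key := tendsto_tsum_of_dominated_convergence (𝓕 := (atTop : Filter ℕ))
    (f := fun (N : ℕ) (r : ℕ) => if r ∈ Finset.range (Nat.log p N + 1) then
      charL f p m r * (p : ℝ) ^ (-(a1 * r)) * (1 - (r : ℝ) / Real.logb p N) ^ b1 else 0)
    (g := fun r : ℕ => charL f p m r * (p : ℝ) ^ (-(a1 * r)))
    (bound := fun r : ℕ => ‖charL f p m r * (p : ℝ) ^ (-(a1 * r))‖) hsum.norm ?_ ?_
  · refine key.congr fun N => ?_
    rw [tsum_eq_sum (s := Finset.range (Nat.log p N + 1))]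
    · exact Finset.sum_congr rfl fun r hr => if_pos hr
    · intro r hr
      exact if_neg hr
  · intro r
    have h1 : Tendsto (fun N : ℕ => (1 - (r : ℝ) / Real.logb p N) ^ b1) atTop (nhds 1) := by
      have h2 : Tendsto (fun N : ℕ => 1 - (r : ℝ) / Real.logb p N) atTop (nhds 1) := by
        simpa using (hlog.const_div_atTop (r : ℝ)).const_sub 1
      simpa using h2.rpow_const (p := b1) (Or.inl one_ne_zero)
    have h3 := h1.const_mul (charL f p m r * (p : ℝ) ^ (-(a1 * r)))
    rw [mul_one] at h3
    refine h3.congr' ?_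
    filter_upwards [eventually_ge_atTop (p ^ r)] with N hN
    have hr : r ≤ Nat.log p N := by
      simpa [Nat.log_pow hp.one_lt] using Nat.log_mono_right (b := p) hN
    rw [if_pos (Finset.mem_range.2 (by omega))]
  · filter_upwards [eventually_ge_atTop 1] with N hN r
    split_ifs with h
    · rw [norm_mul]
      refine mul_le_of_le_one_right (norm_nonneg _) ?_
      have hr : r ≤ Nat.log p N := by
        have := Finset.mem_range.1 h
        omega
      have hpow : p ^ r ≤ N := Nat.pow_le_of_le_log (by omega) hr
      have hle : (r : ℝ) ≤ Real.logb p N := by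
        rw [Real.le_logb_iff_rpow_le hp1 (by exact_mod_cast hN), Real.rpow_natCast]
        exact_mod_cast hpow
      have hr0 : (0 : ℝ) ≤ r := Nat.cast_nonneg r
      have h4 : 0 ≤ 1 - (r : ℝ) / Real.logb p N := by
        have := div_le_one_of_le₀ hle (hr0.trans hle)
        linarith
      have h5 : 1 - (r : ℝ) / Real.logb p N ≤ 1 := by
        have := div_nonneg hr0 (hr0.trans hle)
        linarith
      rw [Real.norm_eq_abs, abs_of_nonneg (Real.rpow_nonneg h4 _)]
      exact Real.rpow_le_one h4 h5 hb1
    · rw [norm_zero]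
      exact norm_nonneg _
end

section
/- Let f be a multiplicative arithmetic function belonging to the universality class ℬ{N^{a1}(log N)^{b1}; G2(N)} with a1 > 0 and b1 < 0, let p be a prime and m ≥ 0 an integer, and suppose there exist real numbers K > 0 and γ < a1 and an integer r* ≥ 0 such that |L_r(f;p^m)| ≤ K·p^{γr} for all r ≥ r*. Then the truncated sum ℛ₁(f;N,p^m) = ∑_{r=0}^{⌊log_p N⌋−1} L_r(f;p^m)·p^{−a1·r}·(1 − r/log_p N)^{b1} tends to ∑_{r=0}^{∞} L_r(f;p^m)·p^{−a1·r} as N → ∞ (the latter series being convergent). -/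
open Filter

/-- Lemma 2 of the paper: for `a1 > 0`, `b1 < 0`, the truncated main
sum `ℛ₁(f;N,p^m)` converges to `∑_{r=0}^{∞} L_r(f;p^m) p^{-a1 r}`. -/
theorem main_sum_limit_neg_b1
    (f : ℕ → ℝ) (a1 b1 : ℝ) (G2 : ℕ → ℝ) (p m : ℕ)
    (hf : IsMultiplicativeFn f) (hp : p.Prime)
    (ha1 : 0 < a1) (hb1 : b1 < 0)
    (hG2pos : ∀ N : ℕ, 0 < G2 N) (hG2anti : Antitone G2)
    (hclass : InUniversalityClassG f a1 b1 G2)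
    (K γ : ℝ) (hK : 0 < K) (hγ : γ < a1) (rstar : ℕ)
    (hL : ∀ r : ℕ, rstar ≤ r → |charL f p m r| ≤ K * (p : ℝ) ^ (γ * r)) :
    Summable (fun r : ℕ => charL f p m r * (p : ℝ) ^ (-(a1 * r))) ∧
    Tendsto (fun N : ℕ =>
        ∑ r ∈ Finset.range (Nat.log p N),
          charL f p m r * (p : ℝ) ^ (-(a1 * r)) *
            (1 - (r : ℝ) / Real.logb p N) ^ b1)
      atTop (nhds (∑' r : ℕ, charL f p m r * (p : ℝ) ^ (-(a1 * r)))) := by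
  have hp1 : (1:ℝ) < p := by exact_mod_cast hp.one_lt
  have hp0 : (0:ℝ) < p := by linarith
  set a : ℕ → ℝ := fun r : ℕ => charL f p m r * (p : ℝ) ^ (-(a1 * r)) with ha
  set q : ℝ := (p:ℝ) ^ (γ - a1) with hq
  have hq0 : 0 < q := Real.rpow_pos_of_pos hp0 _
  have hq1 : q < 1 := Real.rpow_lt_one_of_one_lt_of_neg hp1 (by linarith)
  obtain ⟨n, hn⟩ := exists_nat_ge (-b1)
  have hsum : Summable (fun r : ℕ => K / q * (((r + 1 : ℕ) : ℝ) ^ n * q ^ (r + 1))) := by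
    apply Summable.mul_left
    have h := summable_pow_mul_geometric_of_norm_lt_one n
      (show ‖q‖ < 1 by rw [Real.norm_of_nonneg hq0.le]; exact hq1)
    exact (summable_nat_add_iff (f := fun r : ℕ => (r : ℝ) ^ n * q ^ r) 1).2 h
  have hab : ∀ r : ℕ, rstar ≤ r → |a r| ≤ K * q ^ r := by
    intro r hr
    have hpos : 0 < (p : ℝ) ^ (-(a1 * r)) := Real.rpow_pos_of_pos hp0 _
    have e : q ^ r = (p : ℝ) ^ (γ * r) * (p : ℝ) ^ (-(a1 * r)) := by
      rw [hq, ← Real.rpow_natCast, ← Real.rpow_mul hp0.le, ← Real.rpow_add hp0]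
      congr 1
      ring
    rw [ha, abs_mul, abs_of_pos hpos, e, ← mul_assoc]
    exact mul_le_mul_of_nonneg_right (hL r hr) hpos.le
  have hbd : Summable (fun r : ℕ => |a r| * (1 + (r : ℝ)) ^ (-b1)) := by
    refine Summable.of_norm_bounded_eventually_nat hsum ?_
    filter_upwards [eventually_ge_atTop rstar] with r hr
    have h1 : (1:ℝ) ≤ 1 + r := by linarith [(Nat.cast_nonneg r : (0:ℝ) ≤ r)]
    have h2 : (1 + (r:ℝ)) ^ (-b1) ≤ (1 + (r:ℝ)) ^ n := by
      rw [← Real.rpow_natCast]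
      exact Real.rpow_le_rpow_of_exponent_le h1 hn
    have h3 : 0 ≤ (1 + (r:ℝ)) ^ (-b1) := Real.rpow_nonneg (by linarith) _
    rw [Real.norm_of_nonneg (mul_nonneg (abs_nonneg _) h3)]
    calc |a r| * (1 + (r:ℝ)) ^ (-b1) ≤ (K * q ^ r) * (1 + (r:ℝ)) ^ n :=
          mul_le_mul (hab r hr) h2 h3 (by positivity)
      _ = _ := by
          push_cast
          field_simp
          ring
  have hsa : Summable a := by
    refine Summable.of_norm_bounded hbd fun r => ?_
    have h1 : (1:ℝ) ≤ 1 + r := by linarith [(Nat.cast_nonneg r : (0:ℝ) ≤ r)]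
    have h2 : (1:ℝ) ≤ (1 + (r:ℝ)) ^ (-b1) := Real.one_le_rpow h1 (by linarith)
    rw [Real.norm_eq_abs]
    exact le_mul_of_one_le_right (abs_nonneg _) h2
  refine ⟨hsa, ?_⟩
  have key := tendsto_tsum_of_dominated_convergence (𝓕 := atTop)
    (f := fun (N : ℕ) (r : ℕ) => if r ∈ Finset.range (Nat.log p N) then
      a r * (1 - (r : ℝ) / Real.logb p N) ^ b1 else 0) (g := a) hbd ?_ ?_
  · refine key.congr fun N => ?_
    rw [tsum_eq_sum (s := Finset.range (Nat.log p N))]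
    · exact Finset.sum_congr rfl fun r hr => if_pos hr
    · intro r hr
      exact if_neg hr
  · intro r
    have hlog : Tendsto (fun N : ℕ => Real.logb p N) atTop atTop :=
      (Real.tendsto_logb_atTop hp1).comp tendsto_natCast_atTop_atTop
    have h1 : Tendsto (fun N : ℕ => 1 - (r : ℝ) / Real.logb p N) atTop (nhds (1 - 0)) :=
      tendsto_const_nhds.sub (hlog.const_div_atTop _)
    rw [sub_zero] at h1
    have h2 := (h1.rpow_const (p := b1) (Or.inl one_ne_zero)).const_mul (a r)
    rw [Real.one_rpow, mul_one] at h2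
    refine h2.congr' ?_
    filter_upwards [eventually_ge_atTop (p ^ (r + 1))] with N hN
    have : r + 1 ≤ Nat.log p N := Nat.le_log_of_pow_le hp.one_lt hN
    rw [if_pos (Finset.mem_range.2 this)]
  · refine Eventually.of_forall fun N r => ?_
    have hr0 : (0:ℝ) ≤ r := Nat.cast_nonneg r
    split_ifs with h
    · have h1 : r + 1 ≤ Nat.log p N := Finset.mem_range.1 h
      have h2 : ((r:ℝ) + 1) ≤ Real.logb p N := by
        have := Real.natLog_le_logb N p
        have h3 : ((r:ℝ) + 1) ≤ (Nat.log p N : ℝ) := by exact_mod_cast h1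
        linarith
      set x := Real.logb p N
      have hx : 0 < x := by linarith
      have h4 : (1 + (r:ℝ))⁻¹ ≤ 1 - r / x := by
        rw [inv_eq_one_div, one_sub_div hx.ne', div_le_div_iff₀ (by linarith) hx]
        nlinarith
      have h5 : 0 < (1 + (r:ℝ))⁻¹ := by positivity
      have h6 : (1 - r / x) ^ b1 ≤ (1 + (r:ℝ)) ^ (-b1) := by
        rw [Real.rpow_neg (by linarith), ← Real.inv_rpow (by linarith)]
        exact Real.rpow_le_rpow_of_nonpos h5 h4 hb1.le
      rw [norm_mul, Real.norm_eq_abs, Real.norm_of_nonneg (Real.rpow_nonneg (by linarith) _)]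
      exact mul_le_mul_of_nonneg_left h6 (abs_nonneg _)
    · rw [norm_zero]
      positivity
end

section
/- Let f be a multiplicative arithmetic function belonging to the universality class ℬ{N^{a1}(log N)^{b1}; N^{−a2}(log N)^{−b2}} with admissible parameters satisfying b1 ≥ b2, let p be a prime and m ≥ 0 an integer, and suppose there exist real numbers K > 0 and γ < a1 and an integer r* ≥ 0 such that |L_r(f;p^m)| ≤ K·p^{γr} for all r ≥ r*. Then for every function E on the positive integers for which there exists C > 0 with |E(n)| ≤ C·n^{−a2}(log n)^{−b2} for all n ≥ 2, the error sum ℛ₂(N) = ∑_{r=0}^{⌊log_p N⌋−1} L_r(f;p^m)·p^{−a1·r}·(1 − r/log_p N)^{b1}·E(⌊N/p^r⌋) tends to 0 as N → ∞. -/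
open Filter

lemma esv_L_bound (L : ℕ → ℝ) (p : ℕ) (hp : 2 ≤ p) (K γ a1 : ℝ) (hK : 0 < K) (rstar : ℕ)
    (hL : ∀ r : ℕ, rstar ≤ r → |L r| ≤ K * (p : ℝ) ^ (γ * r)) :
    ∃ D : ℝ, 0 < D ∧ ∀ r : ℕ, |L r * (p : ℝ) ^ (-(a1 * r))| ≤ D * ((p : ℝ) ^ (γ - a1)) ^ r := by
  have hp0 : (0 : ℝ) < p := by positivity
  have hS : ∀ i : ℕ, 0 ≤ |L i| * (p : ℝ) ^ (-(γ * i)) := fun i => by positivity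
  refine ⟨K + ∑ i ∈ Finset.range rstar, |L i| * (p : ℝ) ^ (-(γ * i)), ?_, ?_⟩
  · have := Finset.sum_nonneg (s := Finset.range rstar) (fun i _ => hS i)
    linarith
  · intro r
    have h0 := Finset.sum_nonneg (s := Finset.range rstar) (fun i _ => hS i)
    have key : |L r| ≤ (K + ∑ i ∈ Finset.range rstar, |L i| * (p : ℝ) ^ (-(γ * i))) *
        (p : ℝ) ^ (γ * r) := by
      by_cases h : rstar ≤ r
      · refine (hL r h).trans ?_
        gcongr
        linarith
      · have h1 := Finset.single_le_sum (fun i _ => hS i) (Finset.mem_range.2 (not_le.1 h))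
        have h2 : |L r| = (|L r| * (p : ℝ) ^ (-(γ * r))) * (p : ℝ) ^ (γ * r) := by
          rw [mul_assoc, ← Real.rpow_add hp0]; simp
        rw [h2]
        gcongr
        linarith
    rw [abs_mul, abs_of_pos (Real.rpow_pos_of_pos hp0 (-(a1 * r)))]
    have h3 : ((p : ℝ) ^ (γ - a1)) ^ r = (p : ℝ) ^ (γ * r) * (p : ℝ) ^ (-(a1 * r)) := by
      rw [← Real.rpow_natCast, ← Real.rpow_mul hp0.le, ← Real.rpow_add hp0]
      congr 1; ring
    rw [h3, ← mul_assoc]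
    gcongr

lemma esv_log_cmp (y z b : ℝ) (hy : 0 < y) (hyz : y ≤ z) (hz : z ≤ 2 * y) :
    y ^ (-b) ≤ 2 ^ |b| * z ^ (-b) := by
  have hz0 : 0 < z := by linarith
  rcases le_total 0 b with h | h
  · rw [abs_of_nonneg h]
    have : (2 * y) ^ (-b) ≤ z ^ (-b) :=
      Real.rpow_le_rpow_of_nonpos hz0 hz (by linarith)
    rw [Real.mul_rpow (by norm_num) hy.le] at this
    calc y ^ (-b) = 2 ^ b * (2 ^ (-b) * y ^ (-b)) := by
          rw [← mul_assoc, ← Real.rpow_add (by norm_num)]; simp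
      _ ≤ _ := by gcongr
  · have h1 : y ^ (-b) ≤ z ^ (-b) := Real.rpow_le_rpow hy.le hyz (by linarith)
    have h2 : (1 : ℝ) ≤ 2 ^ |b| := Real.one_le_rpow (by norm_num) (abs_nonneg _)
    have h3 : 0 ≤ z ^ (-b) := by positivity
    nlinarith

lemma esv_term (E : ℕ → ℝ) (p : ℕ) (hp : 2 ≤ p) (b1 a2 b2 C : ℝ) (hC : 0 < C)
    (ha2 : 0 ≤ a2) (hb : b2 ≤ b1)
    (hE : ∀ n : ℕ, 2 ≤ n → |E n| ≤ C * (n : ℝ) ^ (-a2) * Real.log n ^ (-b2))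
    (N r : ℕ) (hr : r < Nat.log p N) :
    |(1 - (r : ℝ) / Real.logb p N) ^ b1 * E (N / p ^ r)| ≤
      (C * Real.log p ^ (-b2) * 2 ^ |b2|) * Real.logb p N ^ (-b2) *
        ((p : ℝ) ^ (-a2)) ^ (Nat.log p N - r) := by
  have hp0 : (0 : ℝ) < p := by positivity
  have hp1 : (1 : ℝ) < p := by exact_mod_cast hp
  have hN : N ≠ 0 := by rintro rfl; simp at hr
  have hN0 : (0 : ℝ) < N := by positivity
  have hlp : 0 < Real.log p := Real.log_pos hp1
  set M := Nat.log p N with hM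
  set x := Real.logb p N with hx
  set n := N / p ^ r with hn
  have hMx : (M : ℝ) ≤ x := by
    rw [hx, Real.le_logb_iff_rpow_le hp1 hN0, Real.rpow_natCast]
    exact_mod_cast Nat.pow_log_le_self p hN
  have hxM : x < M + 1 := by
    rw [hx, Real.logb_lt_iff_lt_rpow hp1 hN0]
    have := Nat.lt_pow_succ_log_self (by omega : 1 < p) N
    have h2 : (N : ℝ) < (p : ℝ) ^ (M + 1) := by exact_mod_cast this
    rw [← Real.rpow_natCast] at h2
    push_cast at h2
    exact h2
  have hpn : p ^ (M - r) ≤ n := by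
    rw [hn, Nat.le_div_iff_mul_le (by positivity), ← pow_add, Nat.sub_add_cancel hr.le]
    exact Nat.pow_log_le_self p hN
  have hn2 : 2 ≤ n := by
    refine le_trans ?_ hpn
    calc 2 ≤ p ^ 1 := by simpa using hp
      _ ≤ _ := Nat.pow_le_pow_right (by omega) (by omega)
  have hn0 : (0 : ℝ) < n := by positivity
  have hrM : (r : ℝ) + 1 ≤ M := by exact_mod_cast hr
  have hcast : ((M - r : ℕ) : ℝ) = (M : ℝ) - r := by push_cast [hr.le]; ring
  have hr0 : (0 : ℝ) ≤ r := by positivity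
  have hpnR : (p : ℝ) ^ ((M : ℝ) - r) ≤ n := by
    rw [← hcast, Real.rpow_natCast]; exact_mod_cast hpn
  set y := Real.logb p n with hy
  have hy1 : (M : ℝ) - r ≤ y := by
    rw [hy, Real.le_logb_iff_rpow_le hp1 hn0]; exact hpnR
  have hy2 : y ≤ x - r := by
    rw [hy, Real.logb_le_iff_le_rpow hp1 hn0, Real.rpow_sub hp0, hx,
      Real.rpow_logb hp0 hp1.ne' hN0, Real.rpow_natCast]
    have : (n : ℝ) ≤ (N : ℝ) / ((p ^ r : ℕ) : ℝ) := Nat.cast_div_le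
    simpa using this
  have hx0 : 0 < x := by linarith
  have hxr : 0 < x - r := by linarith
  have hlogn : Real.log n = Real.log p * y := by
    rw [hy, Real.logb]; field_simp
  have hd : 1 - (r : ℝ) / x = (x - r) / x := by field_simp
  have hd0 : 0 < 1 - (r : ℝ) / x := by rw [hd]; positivity
  have hd1 : 1 - (r : ℝ) / x ≤ 1 := by
    have : 0 ≤ (r : ℝ) / x := by positivity
    linarith
  have e1 : (1 - (r : ℝ) / x) ^ b1 ≤ (x - r) ^ b2 * x ^ (-b2) := by
    calc (1 - (r : ℝ) / x) ^ b1 ≤ (1 - (r : ℝ) / x) ^ b2 :=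
          Real.rpow_le_rpow_of_exponent_ge hd0 hd1 hb
      _ = _ := by
          rw [hd, Real.div_rpow hxr.le hx0.le, Real.rpow_neg hx0.le]; rfl
  have e2 : Real.log n ^ (-b2) ≤ Real.log p ^ (-b2) * (2 ^ |b2| * (x - r) ^ (-b2)) := by
    rw [hlogn, Real.mul_rpow hlp.le (by linarith)]
    gcongr
    exact esv_log_cmp y (x - r) b2 (by linarith) hy2 (by linarith)
  have e3 : (n : ℝ) ^ (-a2) ≤ ((p : ℝ) ^ (-a2)) ^ (M - r) := by
    calc (n : ℝ) ^ (-a2) ≤ ((p : ℝ) ^ ((M : ℝ) - r)) ^ (-a2) :=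
          Real.rpow_le_rpow_of_nonpos (by positivity) hpnR (by linarith)
      _ = _ := by
          rw [← Real.rpow_natCast, hcast, ← Real.rpow_mul hp0.le, ← Real.rpow_mul hp0.le]
          congr 1; ring
  have e4 : (x - r) ^ b2 * (x - r) ^ (-b2) = 1 := by
    rw [← Real.rpow_add hxr]; simp
  rw [abs_mul, abs_of_pos (Real.rpow_pos_of_pos hd0 b1)]
  have hlogn0 : 0 ≤ Real.log n := Real.log_natCast_nonneg n
  calc (1 - (r : ℝ) / x) ^ b1 * |E n|
      ≤ ((x - r) ^ b2 * x ^ (-b2)) * (C * ((p : ℝ) ^ (-a2)) ^ (M - r) *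
          (Real.log p ^ (-b2) * (2 ^ |b2| * (x - r) ^ (-b2)))) := by
        refine mul_le_mul e1 ((hE n hn2).trans ?_) (abs_nonneg _) (by positivity)
        gcongr
    _ = ((x - r) ^ b2 * (x - r) ^ (-b2)) * ((C * Real.log p ^ (-b2) * 2 ^ |b2|) * x ^ (-b2) *
          ((p : ℝ) ^ (-a2)) ^ (M - r)) := by ring
    _ = _ := by rw [e4, one_mul]

theorem error_sum_vanishes_b1_ge_b2
    (f : ℕ → ℝ) (a1 b1 a2 b2 : ℝ) (p m : ℕ)
    (hf : IsMultiplicativeFn f) (hp : p.Prime)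
    (hadm : AdmissibleParams a1 b1 a2 b2)
    (hb : b2 ≤ b1)
    (hclass : InUniversalityClass f a1 b1 a2 b2)
    (K γ : ℝ) (hK : 0 < K) (hγ : γ < a1) (rstar : ℕ)
    (hL : ∀ r : ℕ, rstar ≤ r → |charL f p m r| ≤ K * (p : ℝ) ^ (γ * r)) :
    ∀ E : ℕ → ℝ,
      (∃ C : ℝ, 0 < C ∧ ∀ n : ℕ, 2 ≤ n →
        |E n| ≤ C * (n : ℝ) ^ (-a2) * Real.log n ^ (-b2)) →
      Tendsto (fun N : ℕ =>
          ∑ r ∈ Finset.range (Nat.log p N),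
            charL f p m r * (p : ℝ) ^ (-(a1 * r)) *
              (1 - (r : ℝ) / Real.logb p N) ^ b1 * E (N / p ^ r))
        atTop (nhds 0) := by
  rintro E ⟨C, hC, hE⟩
  have hp2 := hp.two_le
  have hp0 : (0 : ℝ) < p := by positivity
  have hp1 : (1 : ℝ) < p := by exact_mod_cast hp2
  have hlp : 0 < Real.log p := Real.log_pos hp1
  have ha2 : 0 ≤ a2 := by rcases hadm.2 with h | h <;> linarith
  obtain ⟨D, hD, hDL⟩ := esv_L_bound (charL f p m) p hp2 K γ a1 hK rstar hL
  set q : ℝ := (p : ℝ) ^ (γ - a1) with hq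
  set s : ℝ := (p : ℝ) ^ (-a2) with hs
  have hq0 : 0 < q := by positivity
  have hs0 : 0 < s := by positivity
  have hq1 : q < 1 := Real.rpow_lt_one_of_one_lt_of_neg hp1 (by linarith)
  set G : ℝ := C * Real.log p ^ (-b2) * 2 ^ |b2| with hG
  have hG0 : 0 < G := by positivity
  have hmain : ∀ N : ℕ, |∑ r ∈ Finset.range (Nat.log p N),
            charL f p m r * (p : ℝ) ^ (-(a1 * r)) *
              (1 - (r : ℝ) / Real.logb p N) ^ b1 * E (N / p ^ r)| ≤
      D * G * (Real.logb p N ^ (-b2) *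
        ∑ r ∈ Finset.range (Nat.log p N), q ^ r * s ^ (Nat.log p N - r)) := by
    intro N
    refine (Finset.abs_sum_le_sum_abs _ _).trans ?_
    rw [Finset.mul_sum, Finset.mul_sum]
    refine Finset.sum_le_sum fun r hr => ?_
    have ht := esv_term E p hp2 b1 a2 b2 C hC ha2 hb hE N r (Finset.mem_range.1 hr)
    rw [mul_assoc, abs_mul]
    calc _ ≤ (D * q ^ r) * (G * Real.logb p N ^ (-b2) * s ^ (Nat.log p N - r)) :=
          mul_le_mul (hDL r) ht (abs_nonneg _) (by positivity)
      _ = _ := by ring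
  have hlogb : Tendsto (fun N : ℕ => Real.logb p N) atTop atTop :=
    (Real.tendsto_logb_atTop hp1).comp tendsto_natCast_atTop_atTop
  suffices hT : Tendsto (fun N : ℕ => Real.logb p N ^ (-b2) *
        ∑ r ∈ Finset.range (Nat.log p N), q ^ r * s ^ (Nat.log p N - r)) atTop (nhds 0) by
    have := hT.const_mul (D * G)
    rw [mul_zero] at this
    exact squeeze_zero_norm hmain this
  have hx0 : ∀ᶠ N : ℕ in atTop, 0 < Real.logb p N := hlogb.eventually_gt_atTop 0
  rcases hadm.2 with h | ⟨h, hb2⟩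
  · have hs1 : s < 1 := Real.rpow_lt_one_of_one_lt_of_neg hp1 (by linarith)
    set t := max q s with ht
    have ht0 : 0 < t := lt_max_of_lt_left hq0
    have ht1 : t < 1 := max_lt hq1 hs1
    obtain ⟨k, hk⟩ := exists_nat_ge |b2|
    have hMt : Tendsto (fun N : ℕ => Nat.log p N) atTop atTop := by
      refine tendsto_atTop.2 fun b => ?_
      filter_upwards [eventually_ge_atTop (p ^ b)] with N hN
      exact Nat.le_log_of_pow_le (by omega) hN
    have hlim : Tendsto (fun M : ℕ => t⁻¹ * (((M + 1 : ℕ) : ℝ) ^ (k + 1) * t ^ (M + 1)))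
        atTop (nhds 0) := by
      have := ((tendsto_add_atTop_iff_nat 1).2
        (tendsto_pow_const_mul_const_pow_of_lt_one (k + 1) ht0.le ht1)).const_mul t⁻¹
      simpa using this
    refine squeeze_zero' ?_ ?_ (hlim.comp hMt)
    · filter_upwards [hx0] with N hN
      positivity
    · filter_upwards [hlogb.eventually_ge_atTop 1, eventually_ge_atTop 1] with N hN hN1
      have hN0 : (0 : ℝ) < N := by positivity
      set M := Nat.log p N with hM
      have hxM : Real.logb p N < M + 1 := by
        rw [Real.logb_lt_iff_lt_rpow hp1 hN0]
        have := Nat.lt_pow_succ_log_self (by omega : 1 < p) N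
        have h2 : (N : ℝ) < (p : ℝ) ^ (M + 1) := by exact_mod_cast this
        rw [← Real.rpow_natCast] at h2
        push_cast at h2
        exact h2
      have h1 : Real.logb p N ^ (-b2) ≤ ((M : ℝ) + 1) ^ k := by
        calc Real.logb p N ^ (-b2) ≤ Real.logb p N ^ (k : ℝ) :=
              Real.rpow_le_rpow_of_exponent_le hN ((neg_le_abs b2).trans hk)
          _ = Real.logb p N ^ k := Real.rpow_natCast _ _
          _ ≤ _ := by gcongr
      have h2 : ∑ r ∈ Finset.range M, q ^ r * s ^ (M - r) ≤ ((M : ℝ) + 1) * t ^ M := by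
        calc ∑ r ∈ Finset.range M, q ^ r * s ^ (M - r)
            ≤ ∑ r ∈ Finset.range M, t ^ M := by
              refine Finset.sum_le_sum fun r hr => ?_
              have hr' := (Finset.mem_range.1 hr).le
              calc q ^ r * s ^ (M - r) ≤ t ^ r * t ^ (M - r) := by
                    gcongr
                    · exact le_max_left _ _
                    · exact le_max_right _ _
                _ = t ^ M := by rw [← pow_add, Nat.add_sub_cancel' hr']
          _ = (M : ℝ) * t ^ M := by simp
          _ ≤ _ := by gcongr; linarith
      calc _ ≤ ((M : ℝ) + 1) ^ k * (((M : ℝ) + 1) * t ^ M) := by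
            gcongr
        _ = _ := by
            simp only [Function.comp, ← hM]
            push_cast
            field_simp
            try ring
  · have hs1 : s = 1 := by rw [hs, h]; simp
    have hlim : Tendsto (fun N : ℕ => Real.logb p N ^ (-b2) * (1 - q)⁻¹) atTop (nhds 0) := by
      have := ((tendsto_rpow_neg_atTop hb2).comp hlogb).mul_const (1 - q)⁻¹
      simpa using this
    refine squeeze_zero' ?_ ?_ hlim
    · filter_upwards [hx0] with N hN
      positivity
    · filter_upwards [hx0] with N hN
      gcongr
      simp only [hs1, one_pow, mul_one]
      rw [← tsum_geometric_of_lt_one hq0.le hq1]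
      exact (summable_geometric_of_lt_one hq0.le hq1).sum_le_tsum _ (fun i _ => by positivity)
end

section
/- Let f be a multiplicative arithmetic function belonging to the universality class ℬ{N^{a1}(log N)^{b1}; N^{−a2}(log N)^{−b2}} with admissible parameters satisfying b1 < b2, let p be a prime and m ≥ 0 an integer, and suppose there exist real numbers K > 0 and γ < a1 and an integer r* ≥ 0 such that |L_r(f;p^m)| ≤ K·p^{γr} for all r ≥ r*. Then for every function E on the positive integers for which there exists C > 0 with |E(n)| ≤ C·n^{−a2}(log n)^{−b2} for all n ≥ 2, the error sum ℛ₂(N) = ∑_{r=0}^{⌊log_p N⌋−1} L_r(f;p^m)·p^{−a1·r}·(1 − r/log_p N)^{b1}·E(⌊N/p^r⌋) tends to 0 as N → ∞. -/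
open Filter

/-- The model error `n^{-a2} (log n)^{-b2}` tends to `0`. -/
theorem model_error_tendsto (a2 b2 : ℝ) (h : 0 < a2 ∨ (a2 = 0 ∧ 0 < b2)) :
    Tendsto (fun n : ℕ => (n : ℝ) ^ (-a2) * Real.log n ^ (-b2)) atTop (nhds 0) := by
  suffices H : Tendsto (fun x : ℝ => x ^ (-a2) * Real.log x ^ (-b2)) atTop (nhds 0) from
    H.comp tendsto_natCast_atTop_atTop
  rcases h with h | ⟨rfl, h⟩
  · have h1 := (isLittleO_log_rpow_rpow_atTop (-b2) h).tendsto_div_nhds_zero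
    refine h1.congr' ?_
    filter_upwards [eventually_gt_atTop 0] with x hx
    rw [Real.rpow_neg hx.le, div_eq_mul_inv, mul_comm]
  · have h1 := (tendsto_rpow_neg_atTop h).comp Real.tendsto_log_atTop
    simpa [Function.comp_def] using h1

/-- Lower bound on `1 - r / log_p N` turned into an upper bound for its powers. -/
theorem weight_bound (b x : ℝ) (r k : ℕ) (hk : -b ≤ k) (hx : (r : ℝ) + 1 ≤ x) :
    |(1 - (r : ℝ) / x) ^ b| ≤ ((r : ℝ) + 1) ^ k := by
  have hr : (0 : ℝ) ≤ r := Nat.cast_nonneg r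
  have hx0 : 0 < x := by linarith
  have hlow : ((r : ℝ) + 1)⁻¹ ≤ 1 - (r : ℝ) / x := by
    have h1 : (r : ℝ) / x ≤ r / (r + 1) := by gcongr
    have h2 : ((r : ℝ) + 1)⁻¹ = 1 - r / (r + 1) := by field_simp; ring
    linarith
  have hpos : 0 < 1 - (r : ℝ) / x := lt_of_lt_of_le (by positivity) hlow
  have hle : 1 - (r : ℝ) / x ≤ 1 := by
    have : 0 ≤ (r : ℝ) / x := by positivity
    linarith
  rw [abs_of_nonneg (Real.rpow_nonneg hpos.le _)]
  calc (1 - (r : ℝ) / x) ^ b ≤ (1 - (r : ℝ) / x) ^ (-(k : ℝ)) :=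
        Real.rpow_le_rpow_of_exponent_ge hpos hle (by linarith)
    _ = ((1 - (r : ℝ) / x)⁻¹) ^ k := by
        rw [Real.rpow_neg hpos.le, Real.rpow_natCast, inv_pow]
    _ ≤ ((r : ℝ) + 1) ^ k := by
        gcongr
        exact inv_le_of_inv_le₀ (by positivity) hlow

/-- Summability of the dominating series. -/
theorem dominating_summable (L : ℕ → ℝ) (p k : ℕ) (hp : 2 ≤ p) (a1 K γ : ℝ)
    (hγ : γ < a1) (rstar : ℕ)
    (hL : ∀ r : ℕ, rstar ≤ r → |L r| ≤ K * (p : ℝ) ^ (γ * r)) :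
    Summable (fun r : ℕ => |L r| * (p : ℝ) ^ (-(a1 * r)) * ((r : ℝ) + 1) ^ k) := by
  have hp1 : (1 : ℝ) < p := by exact_mod_cast hp
  have hp0 : (0 : ℝ) < p := by linarith
  set q : ℝ := (p : ℝ) ^ (γ - a1) with hq
  have hq0 : 0 < q := Real.rpow_pos_of_pos hp0 _
  have hq1 : q < 1 := Real.rpow_lt_one_of_one_lt_of_neg hp1 (by linarith)
  have hs := summable_pow_mul_geometric_of_norm_lt_one k
    (r := q) (by rwa [Real.norm_of_nonneg hq0.le])
  have hs2 := ((summable_nat_add_iff 1).2 hs).mul_left (K * q⁻¹)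
  refine Summable.of_norm_bounded_eventually_nat hs2 ?_
  filter_upwards [eventually_ge_atTop rstar] with r hr
  have e : K * (p : ℝ) ^ (γ * r) * (p : ℝ) ^ (-(a1 * r)) = K * q ^ r := by
    rw [mul_assoc, ← Real.rpow_add hp0, hq, ← Real.rpow_natCast, ← Real.rpow_mul hp0.le]
    ring_nf
  have hnn : 0 ≤ |L r| * (p : ℝ) ^ (-(a1 * r)) * ((r : ℝ) + 1) ^ k := by positivity
  rw [Real.norm_of_nonneg hnn]
  calc |L r| * (p : ℝ) ^ (-(a1 * r)) * ((r : ℝ) + 1) ^ k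
      ≤ K * (p : ℝ) ^ (γ * r) * (p : ℝ) ^ (-(a1 * r)) * ((r : ℝ) + 1) ^ k := by
        gcongr
        exact hL r hr
    _ = K * q⁻¹ * (((r + 1 : ℕ) : ℝ) ^ k * q ^ (r + 1)) := by
        rw [e, pow_succ]
        push_cast
        field_simp

/-- Lemma 4 of the paper: for `b1 < b2`, under the growth
constraint on the characteristic functions, the error sum `ℛ₂` tends to `0`. -/
theorem error_sum_vanishes_b1_lt_b2
    (f : ℕ → ℝ) (a1 b1 a2 b2 : ℝ) (p m : ℕ)
    (hf : IsMultiplicativeFn f) (hp : p.Prime)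
    (hadm : AdmissibleParams a1 b1 a2 b2)
    (hb : b1 < b2)
    (hclass : InUniversalityClass f a1 b1 a2 b2)
    (K γ : ℝ) (hK : 0 < K) (hγ : γ < a1) (rstar : ℕ)
    (hL : ∀ r : ℕ, rstar ≤ r → |charL f p m r| ≤ K * (p : ℝ) ^ (γ * r)) :
    ∀ E : ℕ → ℝ,
      (∃ C : ℝ, 0 < C ∧ ∀ n : ℕ, 2 ≤ n →
        |E n| ≤ C * (n : ℝ) ^ (-a2) * Real.log n ^ (-b2)) →
      Tendsto (fun N : ℕ =>
          ∑ r ∈ Finset.range (Nat.log p N),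
            charL f p m r * (p : ℝ) ^ (-(a1 * r)) *
              (1 - (r : ℝ) / Real.logb p N) ^ b1 * E (N / p ^ r))
        atTop (nhds 0) := by
  rintro E ⟨C, hC, hE⟩
  have hp2 : 2 ≤ p := hp.two_le
  have hp1 : (1 : ℝ) < p := by exact_mod_cast hp2
  have hp0 : (0 : ℝ) < p := by linarith
  obtain ⟨k, hk⟩ := exists_nat_ge (-b1)
  have hE0 : Tendsto (fun n => |E n|) atTop (nhds 0) := by
    have h1 := (model_error_tendsto a2 b2 hadm.2).const_mul C
    rw [mul_zero] at h1
    refine squeeze_zero' (Eventually.of_forall fun n => abs_nonneg _) ?_ h1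
    filter_upwards [eventually_ge_atTop 2] with n hn
    rw [← mul_assoc]
    exact hE n hn
  obtain ⟨M, hM⟩ := hE0.bddAbove_range
  have hM' : ∀ n, |E n| ≤ M := fun n => hM ⟨n, rfl⟩
  have hsum := dominating_summable (charL f p m) p k hp2 a1 K γ hγ rstar hL
  set c : ℕ → ℝ := fun r =>
    |charL f p m r| * (p : ℝ) ^ (-(a1 * r)) * ((r : ℝ) + 1) ^ k with hc
  have hc0 : ∀ r, 0 ≤ c r := fun r => by simp only [hc]; positivity
  set t : ℕ → ℕ → ℝ := fun N r =>
    charL f p m r * (p : ℝ) ^ (-(a1 * r)) *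
      (1 - (r : ℝ) / Real.logb p N) ^ b1 * E (N / p ^ r) with ht
  have hbound : ∀ N r, r ∈ Finset.range (Nat.log p N) → |t N r| ≤ c r * |E (N / p ^ r)| := by
    intro N r hr
    rw [Finset.mem_range] at hr
    have hN : N ≠ 0 := by
      rintro rfl
      simp at hr
    have hlog : (r : ℝ) + 1 ≤ Real.logb p N := by
      rw [Real.le_logb_iff_rpow_le hp1 (by positivity)]
      have h1 : p ^ (r + 1) ≤ N := Nat.pow_le_of_le_log hN hr
      have h2 : ((p ^ (r + 1) : ℕ) : ℝ) ≤ N := by exact_mod_cast h1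
      have h3 : (r : ℝ) + 1 = ((r + 1 : ℕ) : ℝ) := by push_cast; ring
      rw [h3, Real.rpow_natCast]
      simpa using h2
    have hw := weight_bound b1 _ r k hk hlog
    simp only [ht, hc, abs_mul]
    rw [abs_of_nonneg (Real.rpow_nonneg hp0.le (-(a1 * (r : ℝ))))]
    gcongr
  have hg : ∀ N, ∑ r ∈ Finset.range (Nat.log p N), t N r =
      ∑' r, (if r ∈ Finset.range (Nat.log p N) then t N r else 0) := by
    intro N
    rw [tsum_eq_sum (s := Finset.range (Nat.log p N))]
    · exact Finset.sum_congr rfl fun r hr => by rw [if_pos hr]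
    · intro r hr
      rw [if_neg hr]
  have hg2 : ∀ N r, |if r ∈ Finset.range (Nat.log p N) then t N r else 0| ≤
      c r * |E (N / p ^ r)| := by
    intro N r
    split_ifs with h
    · exact hbound N r h
    · rw [abs_zero]
      exact mul_nonneg (hc0 r) (abs_nonneg _)
  rw [tendsto_congr hg]
  suffices H : Tendsto (fun N => ∑' r, (if r ∈ Finset.range (Nat.log p N) then t N r else 0))
      atTop (nhds (∑' _ : ℕ, (0 : ℝ))) by
    rwa [tsum_zero] at H
  refine tendsto_tsum_of_dominated_convergence (bound := fun r => c r * M)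
    (hsum.mul_right M) ?_ ?_
  · intro r
    have hdiv : Tendsto (fun N : ℕ => N / p ^ r) atTop atTop :=
      Nat.tendsto_div_const_atTop (pow_ne_zero r hp.ne_zero)
    have h1 := (hE0.comp hdiv).const_mul (c r)
    rw [mul_zero] at h1
    exact squeeze_zero_norm (fun N => hg2 N r) h1
  · exact Eventually.of_forall fun N r =>
      (hg2 N r).trans (mul_le_mul_of_nonneg_left (hM' _) (hc0 r))
end

section
/- Let f be a multiplicative arithmetic function belonging to the universality class ℬ{N^{a1}(log N)^{b1}; G2(N)} with a1 ≥ 0 and b1 a nonnegative integer, let p_1, ..., p_n be n distinct primes and m_1, ..., m_n ≥ 0 integers, and suppose there exist real numbers K > 0 and γ < a1 and an integer r* ≥ 0 such that |L_r(f;p_i^{m_i})| ≤ K·p_i^{γr} for every 1 ≤ i ≤ n and all r ≥ r*. Then the multi-prime sum ℛ₁(N) = ∑_{(r_1,...,r_n) ∈ ℕ^n : ∏_{i=1}^{n} p_i^{r_i} ≤ N} [∏_{i=1}^{n} L_{r_i}(f;p_i^{m_i})·p_i^{−a1·r_i}]·(1 − (∑_{i=1}^{n} r_i·log p_i)/log N)^{b1}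 tends to ∏_{i=1}^{n} ( ∑_{r=0}^{∞} L_r(f;p_i^{m_i})·p_i^{−a1·r} ) as N → ∞. -/
open Filter

theorem aux_prod {α β γ : Type} (e : α × β ≃ γ) (u : α → ℝ) (w : β → ℝ) (z : γ → ℝ)
    (hz : ∀ x, z (e x) = u x.1 * w x.2)
    (hu : Summable fun x => ‖u x‖) (hw : Summable fun x => ‖w x‖) :
    (Summable fun v => ‖z v‖) ∧ ∑' v, z v = (∑' x, u x) * ∑' x, w x := by
  constructor
  · rw [← e.summable_iff]
    exact (hu.mul_norm hw).congr fun x => by simp only [Function.comp, hz]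
  · rw [← e.tsum_eq, tsum_mul_tsum_of_summable_norm hu hw]
    exact tsum_congr hz

theorem aux_pi_sum (n : ℕ) : ∀ (g : Fin n → ℕ → ℝ), (∀ i, Summable fun r => ‖g i r‖) →
    (Summable fun v : Fin n → ℕ => ‖∏ i, g i (v i)‖) ∧
    ∑' v : Fin n → ℕ, ∏ i, g i (v i) = ∏ i, ∑' r, g i r := by
  induction n with
  | zero =>
      intro g _
      refine ⟨(hasSum_fintype _).summable, ?_⟩
      rw [tsum_fintype]
      simp
  | succ n ih =>
      intro g hg
      obtain ⟨h1, h2⟩ := ih (fun i => g i.succ) (fun i => hg i.succ)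
      have key := aux_prod (Fin.consEquiv (fun _ : Fin (n + 1) => ℕ)) (g 0)
        (fun w : Fin n → ℕ => ∏ i : Fin n, g (Fin.succ i) (w i))
        (fun v => ∏ i : Fin (n + 1), g i (v i))
        (fun x => by rw [Fin.prod_univ_succ]; simp [Fin.consEquiv]) (hg 0) (by exact h1)
      refine ⟨key.1, ?_⟩
      rw [Fin.prod_univ_succ, ← h2]
      exact key.2

theorem aux_summable (L : ℕ → ℝ) (p : ℕ) (hp : p.Prime) (a1 K γ : ℝ) (hγ : γ < a1) (rstar : ℕ)
    (hL : ∀ r : ℕ, rstar ≤ r → |L r| ≤ K * (p : ℝ) ^ (γ * r)) :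
    Summable fun r : ℕ => ‖L r * (p : ℝ) ^ (-(a1 * r))‖ := by
  have hp1 : (1 : ℝ) < p := by exact_mod_cast hp.one_lt
  have hp0 : (0 : ℝ) < p := by linarith
  have hq : (p : ℝ) ^ (γ - a1) < 1 := Real.rpow_lt_one_of_one_lt_of_neg hp1 (by linarith)
  have hs : Summable fun r : ℕ => K * ((p : ℝ) ^ (γ - a1)) ^ r :=
    (summable_geometric_of_lt_one (Real.rpow_nonneg hp0.le _) hq).mul_left K
  rw [← summable_nat_add_iff rstar]
  refine Summable.of_nonneg_of_le (fun _ => norm_nonneg _) (fun r => ?_)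
    ((summable_nat_add_iff rstar).2 hs)
  rw [norm_mul, Real.norm_eq_abs, Real.norm_eq_abs, abs_of_pos (Real.rpow_pos_of_pos hp0 _)]
  calc _ ≤ K * (p : ℝ) ^ (γ * ((r + rstar : ℕ) : ℝ)) * (p : ℝ) ^ (-(a1 * ((r + rstar : ℕ) : ℝ))) :=
        mul_le_mul_of_nonneg_right (hL _ (by omega)) (Real.rpow_nonneg hp0.le _)
    _ = _ := by
        rw [mul_assoc, ← Real.rpow_add hp0, ← Real.rpow_mul_natCast hp0.le]
        congr 2
        ring

/-- Lemma 5 of the paper: for `a1 ≥ 0` and `b1` a nonnegative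
integer, the multi-prime main sum `ℛ₁` tends to the product of the one-prime
characteristic series. -/
theorem multiprime_main_sum_limit_nonneg_b1
    (f : ℕ → ℝ) (a1 : ℝ) (b1 : ℕ) (G2 : ℕ → ℝ)
    (n : ℕ) (p : Fin n → ℕ) (m : Fin n → ℕ)
    (hf : IsMultiplicativeFn f) (hp : ∀ i, (p i).Prime)
    (hdist : Function.Injective p)
    (ha1 : 0 ≤ a1)
    (hG2pos : ∀ N : ℕ, 0 < G2 N) (hG2anti : Antitone G2)
    (hclass : InUniversalityClassG f a1 (b1 : ℝ) G2)
    (K γ : ℝ) (hK : 0 < K) (hγ : γ < a1) (rstar : ℕ)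
    (hL : ∀ i : Fin n, ∀ r : ℕ, rstar ≤ r →
      |charL f (p i) (m i) r| ≤ K * (p i : ℝ) ^ (γ * r)) :
    Tendsto (fun N : ℕ =>
        ∑ v ∈ (Fintype.piFinset fun _ : Fin n => Finset.range (N + 1)) |>.filter
            (fun v => ∏ i, p i ^ v i ≤ N),
          (∏ i, charL f (p i) (m i) (v i) * (p i : ℝ) ^ (-(a1 * v i))) *
            (1 - (∑ i, (v i : ℝ) * Real.log (p i)) / Real.log N) ^ (b1 : ℝ))
      atTop
      (nhds (∏ i, ∑' r : ℕ, charL f (p i) (m i) r * (p i : ℝ) ^ (-(a1 * r)))) := by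
  classical
  obtain ⟨hsum, htsum⟩ := aux_pi_sum n
    (fun i r => charL f (p i) (m i) r * (p i : ℝ) ^ (-(a1 * r)))
    (fun i => aux_summable _ _ (hp i) a1 K γ hγ rstar (hL i))
  rw [← htsum]
  simp only [Real.rpow_natCast]
  simp only [fun (h : (Fin n → ℕ) → ℝ) s => sum_eq_tsum_indicator h s]
  refine tendsto_tsum_of_dominated_convergence hsum ?_ ?_
  · intro v
    have hlog : Tendsto (fun N : ℕ => Real.log (N : ℝ)) atTop atTop :=
      Real.tendsto_log_atTop.comp tendsto_natCast_atTop_atTop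
    have h1 : Tendsto (fun N : ℕ =>
        (∏ i, charL f (p i) (m i) (v i) * (p i : ℝ) ^ (-(a1 * v i))) *
          (1 - (∑ i, (v i : ℝ) * Real.log (p i)) / Real.log N) ^ b1) atTop
        (nhds ((∏ i, charL f (p i) (m i) (v i) * (p i : ℝ) ^ (-(a1 * v i))) *
          (1 - 0) ^ b1)) :=
      ((tendsto_const_nhds.sub (hlog.const_div_atTop _)).pow b1).const_mul _
    simp only [sub_zero, one_pow, mul_one] at h1
    refine h1.congr' ?_
    filter_upwards [eventually_ge_atTop (∏ i, p i ^ v i),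
      eventually_all.2 fun i => eventually_ge_atTop (v i)] with N hN hv
    rw [Set.indicator_of_mem]
    simp only [Finset.coe_filter, Set.mem_ofPred_eq, Fintype.mem_piFinset, Finset.mem_range]
    exact ⟨fun i => Nat.lt_succ_of_le (hv i), hN⟩
  · filter_upwards [eventually_ge_atTop 2] with N hN v
    rw [Set.indicator_apply]
    split_ifs with hv
    · simp only [Finset.coe_filter, Set.mem_ofPred_eq] at hv
      have hlogN : 0 < Real.log N := Real.log_pos (by exact_mod_cast hN)
      have hp0 : ∀ i, (0 : ℝ) < p i := fun i => by exact_mod_cast (hp i).pos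
      have hlogp : ∀ i, 0 ≤ Real.log (p i) := fun i => Real.log_natCast_nonneg _
      have hs0 : 0 ≤ ∑ i, (v i : ℝ) * Real.log (p i) :=
        Finset.sum_nonneg fun i _ => mul_nonneg (Nat.cast_nonneg _) (hlogp i)
      have hsN : ∑ i, (v i : ℝ) * Real.log (p i) ≤ Real.log N := by
        have e : ∑ i, (v i : ℝ) * Real.log (p i) = Real.log (∏ i, (p i : ℝ) ^ v i) := by
          rw [Real.log_prod (fun i _ => (pow_pos (hp0 i) _).ne')]
          simp [Real.log_pow]
        rw [e]
        exact Real.log_le_log (Finset.prod_pos fun i _ => pow_pos (hp0 i) _)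
          (by exact_mod_cast hv.2)
      have hd0 := div_nonneg hs0 hlogN.le
      have hd1 := (div_le_one hlogN).2 hsN
      rw [norm_mul]
      refine mul_le_of_le_one_right (norm_nonneg _) ?_
      rw [norm_pow]
      refine pow_le_one₀ (norm_nonneg _) ?_
      rw [Real.norm_eq_abs, abs_le]
      constructor <;> linarith
    · rw [norm_zero]
      exact norm_nonneg _
end

section
/- Let p be a prime and let t be a real-valued function on the powers of p with t(p^0) = 1 satisfying the Hecke-type recursion t(p^{r+1}) = t(p)·t(p^r) − p^{11}·t(p^{r−1}) for all r ≥ 1. Then for every integer m ≥ 1 the characteristic functions of the squared function t² satisfy: L_0(t²;p^m) = t(p^m)², L_1(t²;p^m) = p^{22}·t(p^{m−1})² − 2·p^{11}·t(p)·t(p^{m−1})·t(p^m), and L_r(t²;p^m) = 2·(−p^{11})^r·t(p)·t(p^{m−1})·t(p^m) for all r ≥ 2. -/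
/-- Characteristic functions `L_r(t; p^m)` of a function `t` on the powers of a
prime `p`, encoded by the sequence `T r = t(p^r)`:
`L_0 = T m` and `L_r = T (m+r) - ∑_{j<r} L_j · T (r-j)`. -/
noncomputable def charLSeq (T : ℕ → ℝ) (m : ℕ) : ℕ → ℝ
  | 0 => T m
  | r + 1 =>
      T (m + (r + 1)) -
        ∑ j : Fin (r + 1), charLSeq T m j * T (r + 1 - (j : ℕ))
  decreasing_by exact j.isLt

theorem hecke_add (q : ℝ) (T : ℕ → ℝ) (hT0 : T 0 = 1)
    (h : ∀ r, T (r + 2) = T 1 * T (r + 1) - q * T r) (n r : ℕ) :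
    T (n + 1 + (r + 1)) = T (n + 1) * T (r + 1) - q * T n * T r := by
  induction r generalizing n with
  | zero => rw [hT0, show n + 1 + (0 + 1) = n + 2 by ring, h n]; ring
  | succ r ih =>
    have h1 := ih (n + 1)
    rw [show n + 1 + (r + 1 + 1) = n + 1 + 1 + (r + 1) by ring, h1,
      show n + 1 + 1 = n + 2 from rfl, show r + 1 + 1 = r + 2 from rfl, h n, h r]
    ring

theorem hecke_sum (q : ℝ) (T : ℕ → ℝ) (hT0 : T 0 = 1)
    (h : ∀ r, T (r + 2) = T 1 * T (r + 1) - q * T r) (r : ℕ) :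
    T 1 * ∑ j ∈ Finset.range (r + 1), (-q) ^ j * T (r - j) ^ 2 = T (r + 1) * T r := by
  induction r with
  | zero => simp [hT0]
  | succ r ih =>
    rw [Finset.sum_range_succ']
    have e : ∑ j ∈ Finset.range (r + 1), (-q) ^ (j + 1) * T (r + 1 - (j + 1)) ^ 2
        = (-q) * ∑ j ∈ Finset.range (r + 1), (-q) ^ j * T (r - j) ^ 2 := by
      rw [Finset.mul_sum]
      refine Finset.sum_congr rfl fun j _ => ?_
      rw [Nat.add_sub_add_right]; ring
    rw [e, mul_add, mul_left_comm, ih, show r + 1 + 1 = r + 2 from rfl, h r]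
    simp only [pow_zero, Nat.sub_zero]
    ring

/-- Closed form of the characteristic functions at `m = n + 1`. -/
noncomputable def closedL (q : ℝ) (T : ℕ → ℝ) (n : ℕ) : ℕ → ℝ
  | 0 => T (n + 1) ^ 2
  | j + 1 => (if j = 0 then q ^ 2 * T n ^ 2 else 0)
      + 2 * (-q) ^ (j + 1) * T 1 * T n * T (n + 1)

theorem closedL_sum (q : ℝ) (T : ℕ → ℝ) (hT0 : T 0 = 1)
    (h : ∀ r, T (r + 2) = T 1 * T (r + 1) - q * T r) (n r : ℕ) :
    ∑ j ∈ Finset.range (r + 2), closedL q T n j * T (r + 1 - j) ^ 2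
      = T (n + 1 + (r + 1)) ^ 2 := by
  rw [Finset.sum_range_succ', hecke_add q T hT0 h]
  have e : ∑ j ∈ Finset.range (r + 1), closedL q T n (j + 1) * T (r + 1 - (j + 1)) ^ 2
      = q ^ 2 * T n ^ 2 * T r ^ 2 + (-2 * q * T n * T (n + 1)) *
        (T 1 * ∑ j ∈ Finset.range (r + 1), (-q) ^ j * T (r - j) ^ 2) := by
    have e1 : q ^ 2 * T n ^ 2 * T r ^ 2 = ∑ j ∈ Finset.range (r + 1),
        (if j = 0 then q ^ 2 * T n ^ 2 else 0) * T (r - j) ^ 2 := by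
      simp [ite_mul]
    rw [e1, Finset.mul_sum, Finset.mul_sum, ← Finset.sum_add_distrib]
    refine Finset.sum_congr rfl fun j _ => ?_
    rw [Nat.add_sub_add_right, closedL]; ring
  rw [e, hecke_sum q T hT0 h]
  simp only [closedL, Nat.sub_zero]
  ring

theorem charLSeq_eq_closedL (q : ℝ) (T : ℕ → ℝ) (hT0 : T 0 = 1)
    (h : ∀ r, T (r + 2) = T 1 * T (r + 1) - q * T r) (n r : ℕ) :
    charLSeq (fun r => (T r) ^ 2) (n + 1) r = closedL q T n r := by
  induction r using Nat.strong_induction_on with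
  | _ r ih =>
    cases r with
    | zero => rw [charLSeq, closedL]
    | succ r =>
      have h1 := closedL_sum q T hT0 h n r
      rw [Finset.sum_range_succ, Nat.sub_self, hT0] at h1
      rw [charLSeq]
      have e : ∑ j : Fin (r + 1), charLSeq (fun r => (T r) ^ 2) (n + 1) j
            * T (r + 1 - (j : ℕ)) ^ 2
          = ∑ j ∈ Finset.range (r + 1), closedL q T n j * T (r + 1 - j) ^ 2 := by
        rw [← Fin.sum_univ_eq_sum_range
          (fun j => closedL q T n j * T (r + 1 - j) ^ 2)]
        exact Finset.sum_congr rfl fun j _ => by rw [ih j j.isLt]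
      rw [e]
      linarith

/-- Proposition 3 of the paper: for a Hecke-type sequence
`t(p^{r+1}) = t(p)·t(p^r) − p^{11}·t(p^{r−1})` (such as the Ramanujan τ function
at powers of a prime `p`), the characteristic functions of `t²` satisfy
`L_0(t²;p^m) = t(p^m)²`,
`L_1(t²;p^m) = p^{22}·t(p^{m−1})² − 2p^{11}·t(p)·t(p^{m−1})·t(p^m)`, and
`L_r(t²;p^m) = 2(−p^{11})^r·t(p)·t(p^{m−1})·t(p^m)` for `r ≥ 2`. -/
theorem charL_sq_of_hecke_sequence
    (p : ℕ) (hp : p.Prime) (T : ℕ → ℝ) (hT0 : T 0 = 1)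
    (hrec : ∀ r : ℕ, 1 ≤ r → T (r + 1) = T 1 * T r - (p : ℝ) ^ 11 * T (r - 1)) :
    ∀ m : ℕ, 1 ≤ m →
      charLSeq (fun r => (T r) ^ 2) m 0 = (T m) ^ 2 ∧
      charLSeq (fun r => (T r) ^ 2) m 1 =
        (p : ℝ) ^ 22 * (T (m - 1)) ^ 2 - 2 * (p : ℝ) ^ 11 * T 1 * T (m - 1) * T m ∧
      ∀ r : ℕ, 2 ≤ r →
        charLSeq (fun r => (T r) ^ 2) m r =
          2 * (-(p : ℝ) ^ 11) ^ r * T 1 * T (m - 1) * T m := by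
  intro m hm
  obtain ⟨n, rfl⟩ : ∃ n, m = n + 1 := ⟨m - 1, by omega⟩
  have h : ∀ r, T (r + 2) = T 1 * T (r + 1) - (p : ℝ) ^ 11 * T r := fun r => by
    simpa using hrec (r + 1) (by omega)
  have key := charLSeq_eq_closedL _ T hT0 h n
  rw [Nat.add_sub_cancel]
  refine ⟨?_, ?_, ?_⟩
  · rw [key, closedL]
  · rw [key, closedL, if_pos rfl]; ring
  · intro r hr
    obtain ⟨k, rfl⟩ : ∃ k, r = k + 1 + 1 := ⟨r - 2, by omega⟩
    rw [key, closedL, if_neg (by omega), zero_add]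
end
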